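/- arXiv:2010.07263 — 2 statements merged into one kernel-verified Lean document; each statement's English description precedes it below -/
import Mathlib

section
/- Let l ≤ r and e ∈ ℝ, and let D[l,r;e] be the set of measures μ ∈ D[l,r] with first moment 𝔼(μ) = e. A measure μ is an extreme point of D[l,r;e] if and only if 𝔼(μ) = e and μ = α λ[l,p₁] + (1−α) λ[l,p₂] for some l ≤ p₁ ≤ p₂ ≤ r and 0 < α < 1. -/
open MeasureTheory

/-- `μ ∈ D[l,r]`: `μ = α·δ_l + ρ(x)dx` where `ρ` is nonnegative, nonincreasing on `[l,r]`
and vanishes outside `[l,r]` (the absolutely continuous part has total mass `1 − α`). -/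
def memD (l r : ℝ) (μ : Measure ℝ) : Prop :=
  ∃ α : ℝ, 0 ≤ α ∧ α ≤ 1 ∧ ∃ ρ : ℝ → ℝ,
    (∀ x, 0 ≤ ρ x) ∧ AntitoneOn ρ (Set.Icc l r) ∧ (∀ x ∉ Set.Icc l r, ρ x = 0) ∧
    μ = (ENNReal.ofReal α) • Measure.dirac l
          + volume.withDensity (fun x => ENNReal.ofReal (ρ x))

/-- `μ ∈ D_AC[l,r]`: `μ = ρ(x)dx` with `ρ` nonnegative, nonincreasing on `[l,r]`, vanishing
outside `[l,r]`. -/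
def memDAC (l r : ℝ) (μ : Measure ℝ) : Prop :=
  ∃ ρ : ℝ → ℝ,
    (∀ x, 0 ≤ ρ x) ∧ AntitoneOn ρ (Set.Icc l r) ∧ (∀ x ∉ Set.Icc l r, ρ x = 0) ∧
    μ = volume.withDensity (fun x => ENNReal.ofReal (ρ x))

/-- `λ[l,t]`: normalized Lebesgue measure on `[l,t]` for `l < t`, and `δ_l` for `t = l`. -/
noncomputable def lam (l t : ℝ) : Measure ℝ :=
  if l < t then (ENNReal.ofReal (t - l))⁻¹ • volume.restrict (Set.Icc l t)
  else Measure.dirac l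

/-- The measure `c δ_l + f(x) dx`. -/
noncomputable def atomAdd (l c : ℝ) (f : ℝ → ℝ) : Measure ℝ :=
  ENNReal.ofReal c • Measure.dirac l + volume.withDensity (fun x => ENNReal.ofReal (f x))

/-- Densities that are nonnegative, nonincreasing on `[l,r]` and vanish outside `[l,r]`. -/
structure IsDecreasingDensity (l r : ℝ) (f : ℝ → ℝ) : Prop where
  nonneg : ∀ x, 0 ≤ f x
  antitoneOn : AntitoneOn f (Set.Icc l r)
  eq_zero : ∀ x ∉ Set.Icc l r, f x = 0

namespace IsDecreasingDensity

variable {l r : ℝ} {f g : ℝ → ℝ}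

lemma eq_indicator (hlr : l ≤ r) (hf : IsDecreasingDensity l r f) :
    f = (Set.Icc l r).indicator (fun x => f (Set.projIcc l r hlr x)) := by
  funext x
  by_cases hx : x ∈ Set.Icc l r
  · simp [Set.indicator_of_mem hx, Set.projIcc_of_mem hlr hx]
  · simp [Set.indicator_of_notMem hx, hf.eq_zero x hx]

lemma antitone_extend (hlr : l ≤ r) (hf : IsDecreasingDensity l r f) :
    Antitone (fun x => f (Set.projIcc l r hlr x)) := fun _ _ h =>
  hf.antitoneOn (Subtype.mem _) (Subtype.mem _) (Set.monotone_projIcc hlr h)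

lemma measurable (hlr : l ≤ r) (hf : IsDecreasingDensity l r f) : Measurable f := by
  rw [hf.eq_indicator hlr]
  exact (hf.antitone_extend hlr).measurable.indicator measurableSet_Icc

lemma le_left (hlr : l ≤ r) (hf : IsDecreasingDensity l r f) (x : ℝ) : f x ≤ f l := by
  by_cases hx : x ∈ Set.Icc l r
  · exact hf.antitoneOn (Set.left_mem_Icc.2 hlr) hx hx.1
  · rw [hf.eq_zero x hx]; exact hf.nonneg l

lemma integrable_mul (hlr : l ≤ r) (hf : IsDecreasingDensity l r f) {φ : ℝ → ℝ}
    (hφ : Continuous φ) : Integrable (fun x => φ x * f x) := by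
  have h1 : IntegrableOn φ (Set.Icc l r) := hφ.continuousOn.integrableOn_Icc
  have h2 : Integrable ((Set.Icc l r).indicator φ) := h1.integrable_indicator measurableSet_Icc
  have h3 := h2.mul_bdd (c := f l) (hf.measurable hlr).aestronglyMeasurable
    (Filter.Eventually.of_forall fun x => by
      rw [Real.norm_eq_abs, abs_of_nonneg (hf.nonneg x)]; exact hf.le_left hlr x)
  refine h3.congr (Filter.Eventually.of_forall fun x => ?_)
  by_cases hx : x ∈ Set.Icc l r
  · simp [Set.indicator_of_mem hx]
  · simp [hf.eq_zero x hx]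

lemma integrable (hlr : l ≤ r) (hf : IsDecreasingDensity l r f) : Integrable f := by
  simpa using hf.integrable_mul hlr (φ := fun _ => 1) continuous_const

lemma integrable_id_mul (hlr : l ≤ r) (hf : IsDecreasingDensity l r f) :
    Integrable (fun x => x * f x) := hf.integrable_mul hlr continuous_id

lemma add (hf : IsDecreasingDensity l r f) (hg : IsDecreasingDensity l r g) :
    IsDecreasingDensity l r (fun x => f x + g x) where
  nonneg x := add_nonneg (hf.nonneg x) (hg.nonneg x)
  antitoneOn _ hx _ hy h := add_le_add (hf.antitoneOn hx hy h) (hg.antitoneOn hx hy h)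
  eq_zero x hx := by simp [hf.eq_zero x hx, hg.eq_zero x hx]

lemma const_mul {a : ℝ} (ha : 0 ≤ a) (hf : IsDecreasingDensity l r f) :
    IsDecreasingDensity l r (fun x => a * f x) where
  nonneg x := mul_nonneg ha (hf.nonneg x)
  antitoneOn _ hx _ hy h := mul_le_mul_of_nonneg_left (hf.antitoneOn hx hy h) ha
  eq_zero x hx := by simp [hf.eq_zero x hx]

lemma comp_monotone {φ : ℝ → ℝ} (hφ : Monotone φ) (h0 : φ 0 = 0)
    (hf : IsDecreasingDensity l r f) : IsDecreasingDensity l r (fun x => φ (f x)) where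
  nonneg x := h0 ▸ hφ (hf.nonneg x)
  antitoneOn _ hx _ hy h := hφ (hf.antitoneOn hx hy h)
  eq_zero x hx := by simp [hf.eq_zero x hx, h0]

lemma ae_continuousAt (hlr : l ≤ r) (hf : IsDecreasingDensity l r f) :
    ∀ᵐ x, x ∈ Set.Ioo l r → ContinuousAt f x := by
  have h := (hf.antitone_extend hlr).countable_not_continuousAt.ae_notMem volume
  filter_upwards [h] with x hx hxI
  have hc : ContinuousAt (fun x => f (Set.projIcc l r hlr x)) x := by simpa using hx
  refine hc.congr ?_
  filter_upwards [Ioo_mem_nhds hxI.1 hxI.2] with y hy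
  rw [Set.projIcc_of_mem hlr (Set.Ioo_subset_Icc_self hy)]

end IsDecreasingDensity

section atomAdd

variable {l r c d : ℝ} {f g : ℝ → ℝ}

lemma atomAdd_add (hc : 0 ≤ c) (hd : 0 ≤ d) (hf : ∀ x, 0 ≤ f x) (hg : ∀ x, 0 ≤ g x)
    (hfm : Measurable f) :
    atomAdd l c f + atomAdd l d g = atomAdd l (c + d) (fun x => f x + g x) := by
  have h : (fun x => ENNReal.ofReal (f x + g x)) =
      (fun x => ENNReal.ofReal (f x)) + fun x => ENNReal.ofReal (g x) := by
    funext x; exact ENNReal.ofReal_add (hf x) (hg x)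
  rw [atomAdd, atomAdd, atomAdd, h, withDensity_add_left hfm.ennreal_ofReal,
    ENNReal.ofReal_add hc hd, add_smul]
  abel

lemma smul_atomAdd {a : ℝ} (ha : 0 ≤ a) :
    ENNReal.ofReal a • atomAdd l c f = atomAdd l (a * c) (fun x => a * f x) := by
  have h : (fun x => ENNReal.ofReal (a * f x)) =
      ENNReal.ofReal a • fun x => ENNReal.ofReal (f x) := by
    funext x; exact ENNReal.ofReal_mul ha
  rw [atomAdd, atomAdd, h, withDensity_smul' _ _ ENNReal.ofReal_ne_top, ENNReal.ofReal_mul ha,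
    smul_add, smul_smul]

lemma atomAdd_congr (h : f =ᵐ[volume] g) : atomAdd l c f = atomAdd l c g := by
  rw [atomAdd, atomAdd, withDensity_congr_ae]
  filter_upwards [h] with x hx
  rw [hx]

lemma atomAdd_apply_univ (hlr : l ≤ r) (hc : 0 ≤ c) (hf : IsDecreasingDensity l r f) :
    atomAdd l c f Set.univ = ENNReal.ofReal (c + ∫ x, f x) := by
  rw [ENNReal.ofReal_add hc (integral_nonneg hf.nonneg),
    ofReal_integral_eq_lintegral_ofReal (hf.integrable hlr)
      (Filter.Eventually.of_forall hf.nonneg)]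
  simp [atomAdd]

lemma isProbabilityMeasure_atomAdd_iff (hlr : l ≤ r) (hc : 0 ≤ c)
    (hf : IsDecreasingDensity l r f) :
    IsProbabilityMeasure (atomAdd l c f) ↔ c + ∫ x, f x = 1 := by
  rw [isProbabilityMeasure_iff, atomAdd_apply_univ hlr hc hf, ENNReal.ofReal_eq_one]

lemma integral_atomAdd (hlr : l ≤ r) (hc : 0 ≤ c) (hf : IsDecreasingDensity l r f) :
    ∫ x, x ∂(atomAdd l c f) = c * l + ∫ x, x * f x := by
  have hm := (hf.measurable hlr).ennreal_ofReal
  have hlt : ∀ᵐ x, ENNReal.ofReal (f x) < ⊤ :=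
    Filter.Eventually.of_forall fun x => ENNReal.ofReal_lt_top
  have hfi : ∀ x : ℝ, (ENNReal.ofReal (f x)).toReal • x = x * f x := fun x => by
    rw [ENNReal.toReal_ofReal (hf.nonneg x), smul_eq_mul, mul_comm]
  rw [atomAdd, integral_add_measure, integral_smul_measure, integral_dirac,
    integral_withDensity_eq_integral_toReal_smul hm hlt, ENNReal.toReal_ofReal hc]
  · simp only [hfi, smul_eq_mul]
  · exact (integrable_dirac (by simp)).smul_measure ENNReal.ofReal_ne_top
  · rw [integrable_withDensity_iff_integrable_smul' hm hlt]
    simpa only [hfi] using hf.integrable_id_mul hlr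

lemma eq_of_atomAdd_eq (hlr : l ≤ r) (hc : 0 ≤ c) (hd : 0 ≤ d)
    (hf : IsDecreasingDensity l r f) (hg : IsDecreasingDensity l r g)
    (h : atomAdd l c f = atomAdd l d g) : c = d ∧ f =ᵐ[volume] g := by
  have hcd : ENNReal.ofReal c = ENNReal.ofReal d := by
    have := congrArg (fun ν : Measure ℝ => ν {l}) h
    simpa [atomAdd] using this
  have hw : volume.withDensity (fun x => ENNReal.ofReal (f x)) =
      volume.withDensity (fun x => ENNReal.ofReal (g x)) := by
    ext s hs
    have := congrArg (fun ν : Measure ℝ => ν s) h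
    simp only [atomAdd, hcd, Measure.add_apply] at this
    refine (ENNReal.add_right_inj ?_).1 this
    exact ENNReal.mul_ne_top ENNReal.ofReal_ne_top (measure_ne_top _ _)
  rw [withDensity_eq_iff (hf.measurable hlr).ennreal_ofReal.aemeasurable
    (hg.measurable hlr).ennreal_ofReal.aemeasurable] at hw
  · refine ⟨(ENNReal.ofReal_eq_ofReal_iff hc hd).1 hcd, ?_⟩
    filter_upwards [hw] with x hx
    exact (ENNReal.ofReal_eq_ofReal_iff (hf.nonneg x) (hg.nonneg x)).1 hx
  · rw [← ofReal_integral_eq_lintegral_ofReal (hf.integrable hlr)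
      (Filter.Eventually.of_forall hf.nonneg)]
    exact ENNReal.ofReal_ne_top

lemma memD.exists_atomAdd {μ : Measure ℝ} (h : memD l r μ) :
    ∃ c f, 0 ≤ c ∧ IsDecreasingDensity l r f ∧ μ = atomAdd l c f := by
  obtain ⟨c, hc, -, f, h1, h2, h3, rfl⟩ := h
  exact ⟨c, f, hc, ⟨h1, h2, h3⟩, rfl⟩

lemma memD_atomAdd (hlr : l ≤ r) (hc : 0 ≤ c) (hf : IsDecreasingDensity l r f)
    (h : IsProbabilityMeasure (atomAdd l c f)) : memD l r (atomAdd l c f) := by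
  rw [isProbabilityMeasure_atomAdd_iff hlr hc hf] at h
  have : 0 ≤ ∫ x, f x := integral_nonneg hf.nonneg
  exact ⟨c, hc, by linarith, f, hf.nonneg, hf.antitoneOn, hf.eq_zero, rfl⟩

end atomAdd

lemma isDecreasingDensity_indicator {l r p K : ℝ} (hpr : p ≤ r) (hK : 0 ≤ K) :
    IsDecreasingDensity l r ((Set.Icc l p).indicator fun _ => K) where
  nonneg x := Set.indicator_nonneg (fun _ _ => hK) x
  antitoneOn x hx y hy h := by
    by_cases hyp : y ∈ Set.Icc l p
    · have hxp : x ∈ Set.Icc l p := ⟨hx.1, h.trans hyp.2⟩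
      rw [Set.indicator_of_mem hyp, Set.indicator_of_mem hxp]
    · rw [Set.indicator_of_notMem hyp]
      exact Set.indicator_nonneg (fun _ _ => hK) x
  eq_zero x hx := Set.indicator_of_notMem (fun h => hx ⟨h.1, h.2.trans hpr⟩) _

lemma lam_self (l : ℝ) : lam l l = atomAdd l 1 (fun _ => 0) := by
  simp [lam, atomAdd]

lemma atomAdd_indicator_Icc {l p K : ℝ} (hlp : l ≤ p) (hK : 0 ≤ K) :
    atomAdd l 0 ((Set.Icc l p).indicator fun _ => K) = ENNReal.ofReal (K * (p - l)) • lam l p := by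
  have h : (fun x => ENNReal.ofReal ((Set.Icc l p).indicator (fun _ => K) x)) =
      (Set.Icc l p).indicator fun _ => ENNReal.ofReal K := by
    funext x
    by_cases hx : x ∈ Set.Icc l p <;> simp [hx]
  rw [atomAdd, h, withDensity_indicator measurableSet_Icc, withDensity_const, lam]
  rcases hlp.eq_or_lt with rfl | hlt
  · simp
  · rw [if_pos hlt, smul_smul, ENNReal.ofReal_mul hK, mul_assoc, ENNReal.mul_inv_cancel]
    · simp
    · simpa using hlt
    · exact ENNReal.ofReal_ne_top

lemma exists_lam_eq_atomAdd {l r p : ℝ} (hlp : l ≤ p) (hpr : p ≤ r) :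
    ∃ c f k, 0 ≤ c ∧ IsDecreasingDensity l r f ∧ lam l p = atomAdd l c f ∧ (l < p → c = 0) ∧
      (∀ x ∈ Set.Ioo l p, f x = k) ∧ ∀ x ∉ Set.Icc l p, f x = 0 := by
  rcases hlp.eq_or_lt with rfl | hlt
  · exact ⟨1, fun _ => 0, 0, zero_le_one, ⟨by simp, fun _ _ _ _ _ => le_rfl, by simp⟩,
      lam_self l, fun h => absurd h (lt_irrefl _), fun _ _ => rfl, fun _ _ => rfl⟩
  · have h0 : 0 < p - l := sub_pos.2 hlt
    refine ⟨0, _, (p - l)⁻¹, le_rfl, isDecreasingDensity_indicator hpr (inv_nonneg.2 h0.le), ?_,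
      fun _ => rfl, fun x hx => Set.indicator_of_mem (Set.Ioo_subset_Icc_self hx) _,
      fun x hx => Set.indicator_of_notMem hx _⟩
    rw [atomAdd_indicator_Icc hlp (inv_nonneg.2 h0.le), inv_mul_cancel₀ h0.ne']
    simp

lemma ae_eq_const_of_antitoneOn_of_add_eq_const {f g : ℝ → ℝ} {s : Set ℝ} {α β K : ℝ}
    (hf : AntitoneOn f s) (hg : AntitoneOn g s) (hα : 0 < α) (hβ : 0 < β)
    (h : ∀ᵐ x, x ∈ s → α * f x + β * g x = K) : ∃ k, ∀ᵐ x, x ∈ s → f x = k := by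
  by_cases hne : ∃ x₀ ∈ s, α * f x₀ + β * g x₀ = K
  · obtain ⟨x₀, hx₀, h₀⟩ := hne
    refine ⟨f x₀, ?_⟩
    filter_upwards [h] with x hx hxs
    have hK := hx hxs
    rcases le_total x x₀ with hle | hle
    · have h1 := hf hxs hx₀ hle
      have h2 := hg hxs hx₀ hle
      nlinarith
    · have h1 := hf hx₀ hxs hle
      have h2 := hg hx₀ hxs hle
      nlinarith
  · push Not at hne
    refine ⟨0, ?_⟩
    filter_upwards [h] with x hx hxs
    exact absurd (hx hxs) (hne x hxs)

/-- Equality almost everywhere with the step function worth `A` on `(l,p)`, `B` on `(p,q)`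
and `0` outside `[l,q]`. -/
def IsTwoStep (l p q A B : ℝ) (f : ℝ → ℝ) : Prop :=
  f =ᵐ[volume] fun x =>
    (Set.Ioc l p).indicator (fun _ => A) x + (Set.Ioc p q).indicator (fun _ => B) x

lemma isTwoStep_of_ae {l p q A B : ℝ} {f : ℝ → ℝ} (hlp : l ≤ p)
    (hA : ∀ᵐ x, x ∈ Set.Ioo l p → f x = A) (hB : ∀ᵐ x, x ∈ Set.Ioo p q → f x = B)
    (h0 : ∀ᵐ x, x ∉ Set.Icc l q → f x = 0) : IsTwoStep l p q A B f := by
  filter_upwards [hA, hB, h0, Measure.ae_ne volume l, Measure.ae_ne volume p,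
    Measure.ae_ne volume q] with x hxA hxB hx0 hl hp hq
  simp only [Set.indicator_apply, Set.mem_Ioc]
  rcases lt_or_gt_of_ne hl with h1 | h1
  · rw [hx0 fun h => absurd h.1 (not_le.2 h1), if_neg fun h => absurd h.1 h1.not_gt,
      if_neg fun h => absurd (hlp.trans_lt h.1) h1.not_gt, add_zero]
  rcases lt_or_gt_of_ne hp with h2 | h2
  · rw [hxA ⟨h1, h2⟩, if_pos ⟨h1, h2.le⟩, if_neg fun h => absurd h.1 h2.not_gt, add_zero]
  rcases lt_or_gt_of_ne hq with h3 | h3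
  · rw [hxB ⟨h2, h3⟩, if_neg fun h => absurd h.2 (not_le.2 h2), if_pos ⟨h2, h3.le⟩, zero_add]
  · rw [hx0 fun h => absurd h.2 (not_le.2 h3), if_neg fun h => absurd h.2 (not_le.2 h2),
      if_neg fun h => absurd h.2 (not_le.2 h3), add_zero]

lemma integral_mul_indicator_Ioc {a b K : ℝ} (hab : a ≤ b) {φ : ℝ → ℝ} :
    ∫ x, φ x * (Set.Ioc a b).indicator (fun _ => K) x = K * ∫ x in a..b, φ x := by
  rw [intervalIntegral.integral_of_le hab, ← integral_const_mul,
    ← integral_indicator measurableSet_Ioc]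
  congr 1
  funext x
  by_cases hx : x ∈ Set.Ioc a b <;> simp [hx, mul_comm]

lemma integrable_mul_indicator_Ioc {a b K : ℝ} {φ : ℝ → ℝ} (hφ : Continuous φ) :
    Integrable fun x => φ x * (Set.Ioc a b).indicator (fun _ => K) x := by
  have h : IntegrableOn (fun x => φ x * K) (Set.Ioc a b) :=
    ((hφ.mul continuous_const).continuousOn.integrableOn_Icc).mono_set Set.Ioc_subset_Icc_self
  refine (h.integrable_indicator measurableSet_Ioc).congr (Filter.Eventually.of_forall fun x => ?_)
  by_cases hx : x ∈ Set.Ioc a b <;> simp [hx]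

lemma IsTwoStep.integral_mul {l p q A B : ℝ} {f φ : ℝ → ℝ} (h : IsTwoStep l p q A B f)
    (hlp : l ≤ p) (hpq : p ≤ q) (hφ : Continuous φ) :
    ∫ x, φ x * f x = A * (∫ x in l..p, φ x) + B * ∫ x in p..q, φ x := by
  rw [← integral_mul_indicator_Ioc hlp, ← integral_mul_indicator_Ioc hpq,
    ← integral_add (integrable_mul_indicator_Ioc hφ) (integrable_mul_indicator_Ioc hφ)]
  refine integral_congr_ae ?_
  filter_upwards [h] with x hx
  rw [hx, mul_add]

lemma IsTwoStep.integral_eq {l p q A B : ℝ} {f : ℝ → ℝ} (h : IsTwoStep l p q A B f)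
    (hlp : l ≤ p) (hpq : p ≤ q) : ∫ x, f x = A * (p - l) + B * (q - p) := by
  simpa using h.integral_mul hlp hpq (φ := fun _ => 1) continuous_const

lemma IsTwoStep.integral_id_mul {l p q A B : ℝ} {f : ℝ → ℝ} (h : IsTwoStep l p q A B f)
    (hlp : l ≤ p) (hpq : p ≤ q) :
    ∫ x, x * f x = A * ((p ^ 2 - l ^ 2) / 2) + B * ((q ^ 2 - p ^ 2) / 2) := by
  simpa using h.integral_mul hlp hpq (φ := fun x => x) continuous_id

/-- A decreasing two-step density with possible atom at `l` (only when the first step is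
trivial) is determined by its mass and first moment. -/
lemma IsTwoStep.atomAdd_eq {l p q A₁ B₁ A₂ B₂ c₁ c₂ : ℝ} {f₁ f₂ : ℝ → ℝ}
    (h₁ : IsTwoStep l p q A₁ B₁ f₁) (h₂ : IsTwoStep l p q A₂ B₂ f₂) (hlp : l ≤ p) (hpq : p ≤ q)
    (hc₁ : l < p → c₁ = 0) (hc₂ : l < p → c₂ = 0)
    (hmass : c₁ + ∫ x, f₁ x = c₂ + ∫ x, f₂ x)
    (hmean : c₁ * l + ∫ x, x * f₁ x = c₂ * l + ∫ x, x * f₂ x) :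
    atomAdd l c₁ f₁ = atomAdd l c₂ f₂ := by
  rw [h₁.integral_eq hlp hpq, h₂.integral_eq hlp hpq] at hmass
  rw [h₁.integral_id_mul hlp hpq, h₂.integral_id_mul hlp hpq] at hmean
  have hB : p < q → B₁ = B₂ := fun hlt => by
    have hql : 0 < q - l := by linarith
    have hqp : 0 < q - p := by linarith
    have key : (B₁ - B₂) * ((q - p) * (q - l)) = 0 := by
      rcases hlp.eq_or_lt with rfl | hlp'
      · linear_combination 2 * hmean - 2 * l * hmass
      · rw [hc₁ hlp', hc₂ hlp'] at hmean hmass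
        linear_combination 2 * hmean - (p + l) * hmass
    exact sub_eq_zero.1 ((mul_eq_zero.1 key).resolve_right (mul_pos hqp hql).ne')
  have hB' : B₁ * (q - p) = B₂ * (q - p) := by
    rcases hpq.eq_or_lt with rfl | hlt
    · simp
    · rw [hB hlt]
  have hA : l < p → A₁ = A₂ := fun hlt => by
    have hpl : 0 < p - l := by linarith
    rw [hc₁ hlt, hc₂ hlt] at hmass
    exact mul_right_cancel₀ hpl.ne' (by linarith : A₁ * (p - l) = A₂ * (p - l))
  have hc : c₁ = c₂ := by
    rcases hlp.eq_or_lt with rfl | hlt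
    · simp only [sub_self, mul_zero] at hmass
      linarith
    · rw [hc₁ hlt, hc₂ hlt]
  rw [hc, atomAdd_congr h₁, atomAdd_congr h₂]
  congr 1
  funext x
  congr 1
  · by_cases hx : x ∈ Set.Ioc l p
    · rw [hA (hx.1.trans_le hx.2)]
    · simp [hx]
  · by_cases hx : x ∈ Set.Ioc p q
    · rw [hB (hx.1.trans_le hx.2)]
    · simp [hx]

lemma exists_isTwoStep_of_convexCombo {l r p q β γ A B : ℝ} {f f₁ f₂ : ℝ → ℝ} (hlp : l ≤ p)
    (hpq : p ≤ q) (hqr : q ≤ r) (h₁ : IsDecreasingDensity l r f₁)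
    (h₂ : IsDecreasingDensity l r f₂) (hβ : 0 < β) (hγ : 0 < γ)
    (hf : f =ᵐ[volume] fun x => β * f₁ x + γ * f₂ x) (hA : ∀ x ∈ Set.Ioo l p, f x = A)
    (hB : ∀ x ∈ Set.Ioo p q, f x = B) (h0 : ∀ x ∉ Set.Icc l q, f x = 0) :
    ∃ A₁ B₁, IsTwoStep l p q A₁ B₁ f₁ := by
  have hs : Set.Ioo l p ⊆ Set.Icc l r := fun x hx => ⟨hx.1.le, hx.2.le.trans (hpq.trans hqr)⟩
  have ht : Set.Ioo p q ⊆ Set.Icc l r := fun x hx => ⟨hlp.trans hx.1.le, hx.2.le.trans hqr⟩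
  obtain ⟨A₁, hA₁⟩ := ae_eq_const_of_antitoneOn_of_add_eq_const (K := A)
    (h₁.antitoneOn.mono hs) (h₂.antitoneOn.mono hs) hβ hγ (by
      filter_upwards [hf] with x hx hxs
      rw [← hx, hA x hxs])
  obtain ⟨B₁, hB₁⟩ := ae_eq_const_of_antitoneOn_of_add_eq_const (K := B)
    (h₁.antitoneOn.mono ht) (h₂.antitoneOn.mono ht) hβ hγ (by
      filter_upwards [hf] with x hx hxs
      rw [← hx, hB x hxs])
  refine ⟨A₁, B₁, isTwoStep_of_ae hlp hA₁ hB₁ ?_⟩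
  filter_upwards [hf] with x hx hxs
  rw [h0 x hxs] at hx
  have h3 := h₁.nonneg x
  have h4 := mul_nonneg hγ.le (h₂.nonneg x)
  nlinarith

lemma exists_perturbation (a b : Fin 3 → ℝ) :
    ∃ s : Fin 3 → ℝ, s ≠ 0 ∧ (∀ i, |s i| ≤ 1) ∧ a 0 * s 0 + a 1 * s 1 + a 2 * s 2 = 0 ∧
      b 0 * s 0 + b 1 * s 1 + b 2 * s 2 = 0 := by
  have hdet : (Matrix.of ![a, b, 0]).det = 0 :=
    Matrix.det_eq_zero_of_row_eq_zero 2 (by simp)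
  obtain ⟨v, hv, hMv⟩ := Matrix.exists_mulVec_eq_zero_iff.2 hdet
  have ha := congrFun hMv 0
  have hb := congrFun hMv 1
  simp only [Matrix.mulVec, dotProduct, Fin.sum_univ_three, Matrix.of_apply, Pi.zero_apply,
    Matrix.cons_val_zero, Matrix.cons_val_one] at ha hb
  have hn : ‖v‖ ≠ 0 := norm_ne_zero_iff.2 hv
  refine ⟨‖v‖⁻¹ • v, smul_ne_zero (inv_ne_zero hn) hv, fun i => ?_, ?_, ?_⟩
  · have h1 : |v i| ≤ ‖v‖ := norm_le_pi_norm v i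
    rw [Pi.smul_apply, smul_eq_mul, abs_mul, abs_inv, abs_norm]
    exact (inv_mul_le_iff₀ (norm_pos_iff.2 hv)).2 (by simpa using h1)
  · simp only [Pi.smul_apply, smul_eq_mul]
    linear_combination ‖v‖⁻¹ * ha
  · simp only [Pi.smul_apply, smul_eq_mul]
    linear_combination ‖v‖⁻¹ * hb

/-- Extremality of `c δ_l + f dx` among the measures of `D[l,r]` with the same first moment,
tested on midpoints. -/
def IsMidpointExtreme (l r c : ℝ) (f : ℝ → ℝ) : Prop :=
  ∀ c₁ c₂ f₁ f₂, 0 ≤ c₁ → 0 ≤ c₂ → IsDecreasingDensity l r f₁ → IsDecreasingDensity l r f₂ →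
    c₁ + ∫ x, f₁ x = c + ∫ x, f x → c₂ + ∫ x, f₂ x = c + ∫ x, f x →
    c₁ * l + ∫ x, x * f₁ x = c * l + ∫ x, x * f x →
    c₂ * l + ∫ x, x * f₂ x = c * l + ∫ x, x * f x →
    c₁ + c₂ = 2 * c → (∀ x, f₁ x + f₂ x = 2 * f x) → c₁ = c₂ ∧ f₁ =ᵐ[volume] f₂

/-- If a decreasing density with atom splits into three layers, then rescaling the layers
without changing mass and first moment shows that an extreme one has linearly dependent layers. -/
lemma IsMidpointExtreme.exists_dependence {l r c : ℝ} {f g₀ g₁ g₂ : ℝ → ℝ} (hlr : l ≤ r)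
    (hc : 0 ≤ c) (h₀ : IsDecreasingDensity l r g₀) (h₁ : IsDecreasingDensity l r g₁)
    (h₂ : IsDecreasingDensity l r g₂) (hsum : ∀ x, f x = g₀ x + g₁ x + g₂ x)
    (hext : IsMidpointExtreme l r c f) :
    ∃ s : Fin 3 → ℝ, s ≠ 0 ∧ s 2 * c = 0 ∧
      ∀ᵐ x, s 0 * g₀ x + s 1 * g₁ x + s 2 * g₂ x = 0 := by
  obtain ⟨s, hs, hs1, hmass, hmean⟩ := exists_perturbation
    ![∫ x, g₀ x, ∫ x, g₁ x, c + ∫ x, g₂ x]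
    ![∫ x, x * g₀ x, ∫ x, x * g₁ x, c * l + ∫ x, x * g₂ x]
  simp only [Matrix.cons_val_zero, Matrix.cons_val_one, Matrix.cons_val] at hmass hmean
  have hI : ∀ {φ : ℝ → ℝ}, Continuous φ → ∀ a₀ a₁ a₂ : ℝ,
      ∫ x, φ x * (a₀ * g₀ x + a₁ * g₁ x + a₂ * g₂ x) =
      a₀ * (∫ x, φ x * g₀ x) + a₁ * (∫ x, φ x * g₁ x) + a₂ * ∫ x, φ x * g₂ x := by
    intro φ hφ a₀ a₁ a₂
    have i₀ := (h₀.integrable_mul hlr hφ).const_mul a₀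
    have i₁ := (h₁.integrable_mul hlr hφ).const_mul a₁
    have i₂ := (h₂.integrable_mul hlr hφ).const_mul a₂
    rw [← integral_const_mul, ← integral_const_mul, ← integral_const_mul, ← integral_add i₀ i₁,
      ← integral_add (by exact i₀.add i₁) i₂]
    congr 1
    funext x
    ring
  have hI1 : ∀ a₀ a₁ a₂ : ℝ, ∫ x, (a₀ * g₀ x + a₁ * g₁ x + a₂ * g₂ x) =
      a₀ * (∫ x, g₀ x) + a₁ * (∫ x, g₁ x) + a₂ * ∫ x, g₂ x := by
    simpa using hI (φ := fun _ => 1) continuous_const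
  have hIx : ∀ a₀ a₁ a₂ : ℝ, ∫ x, x * (a₀ * g₀ x + a₁ * g₁ x + a₂ * g₂ x) =
      a₀ * (∫ x, x * g₀ x) + a₁ * (∫ x, x * g₁ x) + a₂ * ∫ x, x * g₂ x := hI continuous_id
  have hf : f = fun x => 1 * g₀ x + 1 * g₁ x + 1 * g₂ x := by
    funext x; rw [hsum x]; ring
  have hlo : ∀ i, 0 ≤ 1 + s i := fun i => by linarith [(abs_le.1 (hs1 i)).1]
  have hhi : ∀ i, 0 ≤ 1 - s i := fun i => by linarith [(abs_le.1 (hs1 i)).2]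
  obtain ⟨hcc, hff⟩ := hext ((1 + s 2) * c) ((1 - s 2) * c)
    (fun x => (1 + s 0) * g₀ x + (1 + s 1) * g₁ x + (1 + s 2) * g₂ x)
    (fun x => (1 - s 0) * g₀ x + (1 - s 1) * g₁ x + (1 - s 2) * g₂ x)
    (mul_nonneg (hlo 2) hc) (mul_nonneg (hhi 2) hc)
    (((h₀.const_mul (hlo 0)).add (h₁.const_mul (hlo 1))).add (h₂.const_mul (hlo 2)))
    (((h₀.const_mul (hhi 0)).add (h₁.const_mul (hhi 1))).add (h₂.const_mul (hhi 2)))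
    (by rw [hf, hI1, hI1]; linear_combination hmass)
    (by rw [hf, hI1, hI1]; linear_combination -hmass)
    (by rw [hf, hIx, hIx]; linear_combination hmean)
    (by rw [hf, hIx, hIx]; linear_combination -hmean)
    (by ring) (fun x => by rw [hsum x]; ring)
  refine ⟨s, hs, by linarith, ?_⟩
  filter_upwards [hff] with x hx
  linarith

lemma IsMidpointExtreme.not_three_levels {l r c h₁ h₂ : ℝ} {f : ℝ → ℝ} (hlr : l ≤ r)
    (hc : 0 ≤ c) (hf : IsDecreasingDensity l r f) (hext : IsMidpointExtreme l r c f)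
    (hh₁ : 0 ≤ h₁) (hh : h₁ ≤ h₂) (hlow : ∃ᵐ x, 0 < f x ∧ f x < h₁)
    (hmid : ∃ᵐ x, h₁ < f x ∧ f x < h₂) : c = 0 ∧ ¬ ∃ᵐ x, h₂ < f x := by
  have m₀ : Monotone fun t : ℝ => min t h₁ := fun _ _ h => min_le_min_right _ h
  have m₁ : Monotone fun t : ℝ => min (max (t - h₁) 0) (h₂ - h₁) := fun _ _ h =>
    min_le_min_right _ (max_le_max_right _ (by linarith))
  have m₂ : Monotone fun t : ℝ => max (t - h₂) 0 := fun _ _ h =>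
    max_le_max_right _ (by linarith)
  obtain ⟨s, hs, hsc, hdep⟩ := hext.exists_dependence hlr hc
    (hf.comp_monotone m₀ (min_eq_left hh₁))
    (hf.comp_monotone m₁ (by
      rw [max_eq_right (by linarith), min_eq_left (by linarith)]))
    (hf.comp_monotone m₂ (max_eq_right (by linarith)))
    (fun x => by
      rcases le_total (f x) h₁ with h | h
      · rw [min_eq_left h, max_eq_right (by linarith), min_eq_left (by linarith),
          max_eq_right (by linarith)]; ring
      · rw [min_eq_right h, max_eq_left (by linarith)]
        rcases le_total (f x) h₂ with h' | h'
        · rw [min_eq_left (by linarith), max_eq_right (by linarith)]; ring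
        · rw [min_eq_right (by linarith), max_eq_left (by linarith)]; ring)
  have hs0 : s 0 = 0 := by
    obtain ⟨x, ⟨hx1, hx2⟩, hx⟩ := (hlow.and_eventually hdep).exists
    rw [min_eq_left hx2.le, max_eq_right (by linarith), min_eq_left (by linarith),
      max_eq_right (by linarith)] at hx
    simpa [hx1.ne'] using hx
  have hs1 : s 1 = 0 := by
    obtain ⟨x, ⟨hx1, hx2⟩, hx⟩ := (hmid.and_eventually hdep).exists
    rw [hs0, max_eq_left (by linarith : 0 ≤ f x - h₁),
      min_eq_left (by linarith : f x - h₁ ≤ h₂ - h₁),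
      max_eq_right (by linarith : f x - h₂ ≤ 0)] at hx
    simpa [sub_eq_zero, hx1.ne'] using hx
  have hs2 : s 2 ≠ 0 := fun hs2 => hs (by
    funext i
    fin_cases i
    · exact hs0
    · exact hs1
    · exact hs2)
  refine ⟨(mul_eq_zero.1 hsc).resolve_left hs2, fun hhigh => ?_⟩
  obtain ⟨x, hx1, hx⟩ := (hhigh.and_eventually hdep).exists
  rw [hs0, hs1, max_eq_left (by linarith : 0 ≤ f x - h₂)] at hx
  exact hs2 (by simpa [sub_eq_zero, hx1.ne'] using hx)

lemma frequently_ae_of_continuousAt {f : ℝ → ℝ} {x : ℝ} (hx : ContinuousAt f x) {U : Set ℝ}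
    (hU : U ∈ nhds (f x)) : ∃ᵐ y, f y ∈ U :=
  frequently_ae_iff.2 (Measure.measure_pos_of_mem_nhds volume (hx hU)).ne'

lemma exists_two_values {S : Set ℝ} {f : ℝ → ℝ} (hf : ∀ x, 0 ≤ f x)
    (h : ∀ x ∈ S, ∀ y ∈ S, ∀ z ∈ S, f x < f y → f y < f z → f x = 0) :
    ∃ A B, 0 ≤ B ∧ B ≤ A ∧ ∀ x ∈ S, f x = A ∨ f x = B ∨ f x = 0 := by
  by_cases h2 : ∃ x ∈ S, ∃ y ∈ S, 0 < f x ∧ f x < f y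
  · obtain ⟨x, hx, y, hy, hx0, hxy⟩ := h2
    refine ⟨f y, f x, hx0.le, hxy.le, fun z hz => ?_⟩
    by_contra! hne
    obtain ⟨h1, h3, h4⟩ := hne
    rcases lt_or_gt_of_ne h3 with h5 | h5
    · exact h4 (h z hz x hx y hy h5 hxy)
    rcases lt_or_gt_of_ne h1 with h6 | h6
    · exact hx0.ne' (h x hx z hz y hy h5 h6)
    · exact hx0.ne' (h x hx y hy z hz hxy h6)
  · push Not at h2
    by_cases h3 : ∃ x ∈ S, 0 < f x
    · obtain ⟨x, hx, hx0⟩ := h3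
      refine ⟨f x, f x, hx0.le, le_rfl, fun y hy => ?_⟩
      rcases (hf y).eq_or_lt with h4 | h4
      · exact Or.inr (Or.inr h4.symm)
      · exact Or.inl (le_antisymm (h2 x hx y hy hx0) (h2 y hy x hx h4))
    · push Not at h3
      exact ⟨0, 0, le_rfl, le_rfl, fun x hx => Or.inl (le_antisymm (h3 x hx) (hf x))⟩

lemma exists_one_value {S : Set ℝ} {f : ℝ → ℝ} (hf : ∀ x, 0 ≤ f x)
    (h : ∀ x ∈ S, ∀ y ∈ S, f x < f y → f x = 0) :
    ∃ B, 0 ≤ B ∧ ∀ x ∈ S, f x = B ∨ f x = 0 := by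
  by_cases h3 : ∃ x ∈ S, 0 < f x
  · obtain ⟨x, hx, hx0⟩ := h3
    refine ⟨f x, hx0.le, fun y hy => ?_⟩
    rcases lt_trichotomy (f y) (f x) with h4 | h4 | h4
    · exact Or.inr (h y hy x hx h4)
    · exact Or.inl h4
    · exact absurd (h x hx y hy h4) hx0.ne'
  · push Not at h3
    exact ⟨0, le_rfl, fun x hx => Or.inl (le_antisymm (h3 x hx) (hf x))⟩

lemma IsMidpointExtreme.exists_values {l r c : ℝ} {f : ℝ → ℝ} (hlr : l ≤ r)
    (hc : 0 ≤ c) (hf : IsDecreasingDensity l r f) (hext : IsMidpointExtreme l r c f) :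
    ∃ A B, 0 ≤ B ∧ B ≤ A ∧ (0 < c → A = B) ∧
      ∀ᵐ x, x ∈ Set.Ioo l r → f x = A ∨ f x = B ∨ f x = 0 := by
  set S : Set ℝ := {x | ContinuousAt f x}
  have hlevels : ∀ x ∈ S, ∀ y ∈ S, f x < f y → f x ≠ 0 → c = 0 ∧ ∀ z ∈ S, f z ≤ f y := by
    intro x hx y hy hxy hx0
    have hx0' : 0 < f x := (hf.nonneg x).lt_of_ne' hx0
    obtain ⟨h₁, hx1, h1y⟩ := exists_between hxy
    have key : ∀ h₂, f y < h₂ → c = 0 ∧ ¬ ∃ᵐ x, h₂ < f x := fun h₂ hyh =>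
      hext.not_three_levels hlr hc hf (hx0'.trans hx1).le (h1y.trans hyh).le
        (frequently_ae_of_continuousAt hx (Ioo_mem_nhds hx0' hx1))
        (frequently_ae_of_continuousAt hy (Ioo_mem_nhds h1y hyh))
    refine ⟨(key _ (lt_add_one _)).1, fun z hz => ?_⟩
    by_contra! hyz
    obtain ⟨h₂, hyh, hhz⟩ := exists_between hyz
    exact (key h₂ hyh).2 (frequently_ae_of_continuousAt hz (Ioi_mem_nhds hhz))
  have hS : ∀ᵐ x, x ∈ Set.Ioo l r → x ∈ S := hf.ae_continuousAt hlr
  rcases hc.eq_or_lt with hc0 | hc0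
  · obtain ⟨A, B, hB, hBA, hAB⟩ := exists_two_values (S := S) hf.nonneg
      fun x hx y hy z hz hxy hyz => by
        by_contra hx0
        exact absurd ((hlevels x hx y hy hxy hx0).2 z hz) hyz.not_ge
    refine ⟨A, B, hB, hBA, fun h => absurd hc0 h.ne, ?_⟩
    filter_upwards [hS] with x hx hxI using hAB x (hx hxI)
  · obtain ⟨B, hB, hBS⟩ := exists_one_value (S := S) hf.nonneg fun x hx y hy hxy => by
      by_contra hx0
      exact hc0.ne' (hlevels x hx y hy hxy hx0).1
    refine ⟨B, B, hB, le_rfl, fun _ => rfl, ?_⟩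
    filter_upwards [hS] with x hx hxI using Or.inr (hBS x (hx hxI))

lemma IsDecreasingDensity.exists_superlevel {l r : ℝ} {f : ℝ → ℝ} (hlr : l ≤ r)
    (hf : IsDecreasingDensity l r f) (t : ℝ) :
    ∃ p, l ≤ p ∧ p ≤ r ∧ ∀ᵐ x, x ∈ Set.Ioo l r → (x ∈ Set.Icc l p ↔ t ≤ f x) := by
  set T : Set ℝ := insert l {x | x ∈ Set.Icc l r ∧ t ≤ f x}
  have hbdd : BddAbove T := ⟨r, by rintro x (rfl | hx); exacts [hlr, hx.1.2]⟩
  have hne : T.Nonempty := ⟨l, Set.mem_insert _ _⟩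
  refine ⟨sSup T, le_csSup hbdd (Set.mem_insert _ _),
    csSup_le hne (by rintro x (rfl | hx); exacts [hlr, hx.1.2]), ?_⟩
  filter_upwards [Measure.ae_ne volume (sSup T)] with x hx hxI
  have hxI' := Set.Ioo_subset_Icc_self hxI
  refine ⟨fun h => ?_, fun h => ⟨hxI.1.le, le_csSup hbdd (Or.inr ⟨hxI', h⟩)⟩⟩
  obtain ⟨y, hy, hxy⟩ := exists_lt_of_lt_csSup hne (lt_of_le_of_ne h.2 hx)
  rcases hy with rfl | hy
  · exact absurd hxI.1 hxy.not_gt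
  · exact hy.2.trans (hf.antitoneOn hxI' hy.1 hxy.le)

lemma exists_lam_mixture_of_weights {l r p q a b : ℝ} {μ : Measure ℝ} [IsProbabilityMeasure μ]
    (hp : l ≤ p) (hpr : p ≤ r) (hq : l ≤ q) (hqr : q ≤ r) (ha : 0 ≤ a) (hb : 0 ≤ b)
    (hab : a + b = 1) (hμ : μ = ENNReal.ofReal a • lam l p + ENNReal.ofReal b • lam l q) :
    ∃ p₁ p₂ α : ℝ, l ≤ p₁ ∧ p₁ ≤ p₂ ∧ p₂ ≤ r ∧ 0 < α ∧ α < 1 ∧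
      μ = ENNReal.ofReal α • lam l p₁ + ENNReal.ofReal (1 - α) • lam l p₂ := by
  have hhalf : ∀ ν : Measure ℝ, ν = ENNReal.ofReal (1 / 2) • ν + ENNReal.ofReal (1 - 1 / 2) • ν := by
    intro ν
    rw [← add_smul, ← ENNReal.ofReal_add (by norm_num) (by norm_num)]
    norm_num
  rcases ha.eq_or_lt with rfl | ha
  · obtain rfl : b = 1 := by linarith
    refine ⟨q, q, 1 / 2, hq, le_rfl, hqr, by norm_num, by norm_num, ?_⟩
    rw [← hhalf, hμ]; simp
  rcases hb.eq_or_lt with rfl | hb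
  · obtain rfl : a = 1 := by linarith
    refine ⟨p, p, 1 / 2, hp, le_rfl, hpr, by norm_num, by norm_num, ?_⟩
    rw [← hhalf, hμ]; simp
  rcases le_total p q with h | h
  · exact ⟨p, q, a, hp, h, hqr, ha, by linarith, by rw [hμ, ← hab, add_sub_cancel_left]⟩
  · exact ⟨q, p, b, hq, h, hpr, hb, by linarith, by rw [hμ, ← hab, add_sub_cancel_right, add_comm]⟩

lemma IsMidpointExtreme.exists_lam_mixture {l r c : ℝ} {f : ℝ → ℝ} (hlr : l ≤ r) (hc : 0 ≤ c)
    (hf : IsDecreasingDensity l r f) (hprob : IsProbabilityMeasure (atomAdd l c f))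
    (hext : IsMidpointExtreme l r c f) :
    ∃ p₁ p₂ α : ℝ, l ≤ p₁ ∧ p₁ ≤ p₂ ∧ p₂ ≤ r ∧ 0 < α ∧ α < 1 ∧
      atomAdd l c f = ENNReal.ofReal α • lam l p₁ + ENNReal.ofReal (1 - α) • lam l p₂ := by
  obtain ⟨A, B, hB, hBA, hcA, hval⟩ := hext.exists_values hlr hc hf
  obtain ⟨p, hlp, hpr, hp⟩ := hf.exists_superlevel hlr A
  obtain ⟨q, hlq, hqr, hq⟩ := hf.exists_superlevel hlr B
  have hAB : 0 ≤ A - B := sub_nonneg.2 hBA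
  have hp' := isDecreasingDensity_indicator (l := l) hpr hAB
  have hq' := isDecreasingDensity_indicator (l := l) hqr hB
  have hfae : f =ᵐ[volume] fun x => (Set.Icc l p).indicator (fun _ => A - B) x +
      (Set.Icc l q).indicator (fun _ => B) x := by
    filter_upwards [hval, hp, hq, Measure.ae_ne volume l, Measure.ae_ne volume r]
      with x hv hxp hxq hxl hxr
    by_cases hx : x ∈ Set.Icc l r
    · have hxI : x ∈ Set.Ioo l r := ⟨hx.1.lt_of_ne' hxl, hx.2.lt_of_ne hxr⟩
      simp only [Set.indicator_apply, hxp hxI, hxq hxI]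
      rcases hv hxI with h | h | h <;> rw [h] <;> split_ifs <;> linarith
    · rw [hf.eq_zero x hx, hp'.eq_zero x hx, hq'.eq_zero x hx, add_zero]
  have hdecomp : atomAdd l c f = ENNReal.ofReal c • lam l l +
      ENNReal.ofReal ((A - B) * (p - l)) • lam l p + ENNReal.ofReal (B * (q - l)) • lam l q := by
    rw [← atomAdd_indicator_Icc hlp hAB, ← atomAdd_indicator_Icc hlq hB, add_assoc,
      atomAdd_add le_rfl le_rfl hp'.nonneg hq'.nonneg (hp'.measurable hlr), lam_self,
      smul_atomAdd hc, atomAdd_add (by simpa using hc) (by simp) (by simp)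
      (hp'.add hq').nonneg (by fun_prop), atomAdd_congr hfae]
    simp
  have hmass : c + (A - B) * (p - l) + B * (q - l) = 1 := by
    have h1 := (isProbabilityMeasure_atomAdd_iff hlr hc hf).1 hprob
    have h2 : ∀ {t K : ℝ}, l ≤ t → ∫ x, (Set.Icc l t).indicator (fun _ => K) x = K * (t - l) := by
      intro t K ht
      rw [integral_indicator measurableSet_Icc]
      simp [ht, mul_comm]
    rw [integral_congr_ae hfae, integral_add (hp'.integrable hlr) (hq'.integrable hlr), h2 hlp,
      h2 hlq] at h1
    linarith
  have hwp : 0 ≤ (A - B) * (p - l) := mul_nonneg hAB (sub_nonneg.2 hlp)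
  have hwq : 0 ≤ B * (q - l) := mul_nonneg hB (sub_nonneg.2 hlq)
  rcases hc.eq_or_lt with rfl | hc0
  · exact exists_lam_mixture_of_weights hlp hpr hlq hqr hwp hwq (by linarith)
      (by rw [hdecomp]; simp)
  · have hA : (A - B) * (p - l) = 0 := by rw [hcA hc0]; simp
    exact exists_lam_mixture_of_weights le_rfl hlr hlq hqr hc hwq (by linarith)
      (by rw [hdecomp, hA]; simp)

/-- μ is an extreme point of D[l,r;e] (measures of D[l,r] with first moment e)
iff 𝔼(μ) = e and μ = α λ[l,p₁] + (1−α) λ[l,p₂] with l ≤ p₁ ≤ p₂ ≤ r and 0 < α < 1. -/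
theorem stmt11 (l r e : ℝ) (hlr : l ≤ r) (μ : Measure ℝ) [IsProbabilityMeasure μ] :
    ((memD l r μ ∧ (∫ x, x ∂μ) = e) ∧
      ∀ (μ₁ μ₂ : Measure ℝ), IsProbabilityMeasure μ₁ → IsProbabilityMeasure μ₂ →
        memD l r μ₁ → memD l r μ₂ → (∫ x, x ∂μ₁) = e → (∫ x, x ∂μ₂) = e →
        ∀ α : ℝ, 0 < α → α < 1 →
        μ = ENNReal.ofReal α • μ₁ + ENNReal.ofReal (1 - α) • μ₂ → μ₁ = μ₂)
    ↔ ((∫ x, x ∂μ) = e ∧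
        ∃ p₁ p₂ α : ℝ, l ≤ p₁ ∧ p₁ ≤ p₂ ∧ p₂ ≤ r ∧ 0 < α ∧ α < 1 ∧
          μ = ENNReal.ofReal α • lam l p₁ + ENNReal.ofReal (1 - α) • lam l p₂) := by
  constructor
  · rintro ⟨⟨hμ, he⟩, hext⟩
    refine ⟨he, ?_⟩
    obtain ⟨c, f, hc, hf, rfl⟩ := hμ.exists_atomAdd
    have hprob : IsProbabilityMeasure (atomAdd l c f) := inferInstance
    have hmass := (isProbabilityMeasure_atomAdd_iff hlr hc hf).1 hprob
    rw [integral_atomAdd hlr hc hf] at he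
    refine IsMidpointExtreme.exists_lam_mixture hlr hc hf hprob ?_
    intro c₁ c₂ f₁ f₂ hc₁ hc₂ hf₁ hf₂ hm₁ hm₂ he₁ he₂ hcc hff
    have hp₁ := (isProbabilityMeasure_atomAdd_iff hlr hc₁ hf₁).2 (hm₁.trans hmass)
    have hp₂ := (isProbabilityMeasure_atomAdd_iff hlr hc₂ hf₂).2 (hm₂.trans hmass)
    refine eq_of_atomAdd_eq hlr hc₁ hc₂ hf₁ hf₂ (hext _ _ hp₁ hp₂ (memD_atomAdd hlr hc₁ hf₁ hp₁)
      (memD_atomAdd hlr hc₂ hf₂ hp₂) ((integral_atomAdd hlr hc₁ hf₁).trans (he₁.trans he))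
      ((integral_atomAdd hlr hc₂ hf₂).trans (he₂.trans he)) (1 / 2) (by norm_num) (by norm_num) ?_)
    have h2 : (0 : ℝ) ≤ 1 / 2 := by norm_num
    rw [show (1 : ℝ) - 1 / 2 = 1 / 2 by norm_num, smul_atomAdd h2, smul_atomAdd h2,
      atomAdd_add (mul_nonneg h2 hc₁) (mul_nonneg h2 hc₂) (hf₁.const_mul h2).nonneg
        (hf₂.const_mul h2).nonneg ((hf₁.const_mul h2).measurable hlr)]
    congr 1
    · linarith
    · funext x
      linarith [hff x]
  · rintro ⟨he, p₁, p₂, α, hlp, hpp, hpr, hα0, hα1, hμ⟩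
    have hα1' : 0 < 1 - α := sub_pos.2 hα1
    obtain ⟨d₁, u₁, k₁, hd₁, hu₁, hl₁, hd₁0, hk₁, hz₁⟩ := exists_lam_eq_atomAdd hlp (hpp.trans hpr)
    obtain ⟨d₂, u₂, k₂, hd₂, hu₂, hl₂, hd₂0, hk₂, hz₂⟩ :=
      exists_lam_eq_atomAdd (hlp.trans hpp) hpr
    have hu₁' := hu₁.const_mul hα0.le
    have hu₂' := hu₂.const_mul hα1'.le
    have hd : 0 ≤ α * d₁ + (1 - α) * d₂ :=
      add_nonneg (mul_nonneg hα0.le hd₁) (mul_nonneg hα1'.le hd₂)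
    rw [hl₁, hl₂, smul_atomAdd hα0.le, smul_atomAdd hα1'.le,
      atomAdd_add (mul_nonneg hα0.le hd₁) (mul_nonneg hα1'.le hd₂) hu₁'.nonneg hu₂'.nonneg
        (hu₁'.measurable hlr)] at hμ
    refine ⟨⟨?_, he⟩, ?_⟩
    · subst hμ
      exact memD_atomAdd hlr hd (hu₁'.add hu₂') inferInstance
    intro μ₁ μ₂ hp₁ hp₂ hμ₁ hμ₂ he₁ he₂ β hβ0 hβ1 hβ
    have hβ1' : 0 < 1 - β := sub_pos.2 hβ1
    obtain ⟨c₁, f₁, hc₁, hf₁, rfl⟩ := hμ₁.exists_atomAdd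
    obtain ⟨c₂, f₂, hc₂, hf₂, rfl⟩ := hμ₂.exists_atomAdd
    have hf₁' := hf₁.const_mul hβ0.le
    have hf₂' := hf₂.const_mul hβ1'.le
    rw [hμ, smul_atomAdd hβ0.le, smul_atomAdd hβ1'.le,
      atomAdd_add (mul_nonneg hβ0.le hc₁) (mul_nonneg hβ1'.le hc₂) hf₁'.nonneg hf₂'.nonneg
        (hf₁'.measurable hlr)] at hβ
    obtain ⟨hcd, hfu⟩ := eq_of_atomAdd_eq hlr hd
      (add_nonneg (mul_nonneg hβ0.le hc₁) (mul_nonneg hβ1'.le hc₂)) (hu₁'.add hu₂')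
      (hf₁'.add hf₂') hβ
    have hA : ∀ x ∈ Set.Ioo l p₁, α * u₁ x + (1 - α) * u₂ x = α * k₁ + (1 - α) * k₂ :=
      fun x hx => by rw [hk₁ x hx, hk₂ x ⟨hx.1, hx.2.trans_le hpp⟩]
    have hB : ∀ x ∈ Set.Ioo p₁ p₂, α * u₁ x + (1 - α) * u₂ x = (1 - α) * k₂ :=
      fun x hx => by
        rw [hz₁ x fun h => hx.1.not_ge h.2, hk₂ x ⟨hlp.trans_lt hx.1, hx.2⟩, mul_zero, zero_add]
    have h0 : ∀ x ∉ Set.Icc l p₂, α * u₁ x + (1 - α) * u₂ x = 0 := fun x hx => by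
      rw [hz₁ x fun h => hx ⟨h.1, h.2.trans hpp⟩, hz₂ x hx, mul_zero, mul_zero, add_zero]
    obtain ⟨A₁, B₁, hs₁⟩ := exists_isTwoStep_of_convexCombo hlp hpp hpr hf₁ hf₂ hβ0 hβ1' hfu hA hB h0
    obtain ⟨A₂, B₂, hs₂⟩ := exists_isTwoStep_of_convexCombo hlp hpp hpr hf₂ hf₁ hβ1' hβ0
      (hfu.trans (Filter.Eventually.of_forall fun x => add_comm _ _)) hA hB h0
    have hatom : l < p₁ → c₁ = 0 ∧ c₂ = 0 := fun hlt => by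
      rw [hd₁0 hlt, hd₂0 (hlt.trans_le hpp), mul_zero, mul_zero, add_zero] at hcd
      exact ⟨by nlinarith, by nlinarith⟩
    rw [integral_atomAdd hlr hc₁ hf₁] at he₁
    rw [integral_atomAdd hlr hc₂ hf₂] at he₂
    rw [isProbabilityMeasure_atomAdd_iff hlr hc₁ hf₁] at hp₁
    rw [isProbabilityMeasure_atomAdd_iff hlr hc₂ hf₂] at hp₂
    exact hs₁.atomAdd_eq hs₂ hlp hpp (fun h => (hatom h).1) (fun h => (hatom h).2)
      (hp₁.trans hp₂.symm) (he₁.trans he₂.symm)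
end

section
/- An N-tuple of probability measures (μ₁,…,μ_N) is a subextreme point of V^N[C] if and only if there exist real numbers l₁,…,l_N with l₁+⋯+l_N = C and μ_k = δ_{l_k} for all k. -/
open MeasureTheory

/-- A pair of N-tuples (l, r) is a C-compatible boundary if 0 ≤ r_k − l_k ≤ C − Σᵢ lᵢ. -/
def CompatBoundary {N : ℕ} (C : ℝ) (l r : Fin N → ℝ) : Prop :=
  ∀ k, 0 ≤ r k - l k ∧ r k - l k ≤ C - ∑ i, l i

/-- The tuple μ belongs to V^N[C]: Σ 𝔼(μ_k) = C and μ_k ∈ D[l_k,r_k] for some C-compatible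
boundary (l,r). -/
def memV {N : ℕ} (C : ℝ) (μ : Fin N → MeasureTheory.Measure ℝ) : Prop :=
  (∑ k, ∫ x, x ∂(μ k)) = C ∧
  ∃ l r : Fin N → ℝ, CompatBoundary C l r ∧ ∀ k, memD (l k) (r k) (μ k)

/-- The convex cone generated by `D[l,r]`: an atom at `l` plus a nonincreasing density. -/
def MemDCone (l r : ℝ) (μ : Measure ℝ) : Prop :=
  ∃ α : ℝ, 0 ≤ α ∧ ∃ ρ : ℝ → ℝ,
    (∀ x, 0 ≤ ρ x) ∧ AntitoneOn ρ (Set.Icc l r) ∧ (∀ x ∉ Set.Icc l r, ρ x = 0) ∧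
    μ = (ENNReal.ofReal α) • Measure.dirac l
          + volume.withDensity (fun x => ENNReal.ofReal (ρ x))

theorem measurable_of_antitoneOn_Icc {l r : ℝ} {ρ : ℝ → ℝ} (h0 : ∀ x, 0 ≤ ρ x)
    (ha : AntitoneOn ρ (Set.Icc l r)) (hz : ∀ x ∉ Set.Icc l r, ρ x = 0) : Measurable ρ := by
  refine measurable_of_Ioi fun c => ?_
  rcases lt_or_ge c 0 with hc | hc
  · have : ρ ⁻¹' Set.Ioi c = Set.univ := by
      ext x; simpa using hc.trans_le (h0 x)
    rw [this]; exact MeasurableSet.univ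
  · refine Set.OrdConnected.measurableSet ⟨fun x hx y hy z hz' => ?_⟩
    have hmem : ∀ w, w ∈ ρ ⁻¹' Set.Ioi c → w ∈ Set.Icc l r := by
      intro w hw
      by_contra h
      have : c < ρ w := hw
      rw [hz w h] at this
      linarith
    have hy' := hmem y hy
    exact lt_of_lt_of_le (show c < ρ y from hy)
      (ha ⟨(hmem x hx).1.trans hz'.1, hz'.2.trans hy'.2⟩ hy' hz'.2)

theorem MemDCone.add {l r : ℝ} {μ ν : Measure ℝ} (hμ : MemDCone l r μ) (hν : MemDCone l r ν) :
    MemDCone l r (μ + ν) := by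
  obtain ⟨a, ha, ρ, h0, hρ, hz, rfl⟩ := hμ
  obtain ⟨b, hb, σ, k0, hσ, kz, rfl⟩ := hν
  refine ⟨a + b, add_nonneg ha hb, fun x => ρ x + σ x, fun x => add_nonneg (h0 x) (k0 x),
    hρ.add hσ, fun x hx => by simp [hz x hx, kz x hx], ?_⟩
  have : (fun x => ENNReal.ofReal (ρ x + σ x))
      = (fun x => ENNReal.ofReal (ρ x)) + fun x => ENNReal.ofReal (σ x) := by
    ext x; simp [ENNReal.ofReal_add (h0 x) (k0 x)]
  rw [this, withDensity_add_left (measurable_of_antitoneOn_Icc h0 hρ hz).ennreal_ofReal,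
    ENNReal.ofReal_add ha hb, add_smul]
  abel

theorem MemDCone.smul {l r c : ℝ} {μ : Measure ℝ} (hμ : MemDCone l r μ) (hc : 0 ≤ c) :
    MemDCone l r (ENNReal.ofReal c • μ) := by
  obtain ⟨a, ha, ρ, h0, hρ, hz, rfl⟩ := hμ
  refine ⟨c * a, mul_nonneg hc ha, fun x => c * ρ x, fun x => mul_nonneg hc (h0 x),
    fun x hx y hy hxy => mul_le_mul_of_nonneg_left (hρ hx hy hxy) hc,
    fun x hx => by simp [hz x hx], ?_⟩
  have : (fun x => ENNReal.ofReal (c * ρ x))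
      = ENNReal.ofReal c • fun x => ENNReal.ofReal (ρ x) := by
    ext x; simp [ENNReal.ofReal_mul hc]
  rw [this, withDensity_smul _ (measurable_of_antitoneOn_Icc h0 hρ hz).ennreal_ofReal,
    ENNReal.ofReal_mul hc, smul_add, smul_smul]

theorem memDCone_of_memD {l r : ℝ} {μ : Measure ℝ} (h : memD l r μ) : MemDCone l r μ := by
  obtain ⟨a, ha, -, h⟩ := h
  exact ⟨a, ha, h⟩

theorem MemDCone.memD {l r : ℝ} {μ : Measure ℝ} [IsProbabilityMeasure μ] (h : MemDCone l r μ) :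
    memD l r μ := by
  obtain ⟨a, ha, ρ, h0, hρ, hz, he⟩ := h
  refine ⟨a, ha, ?_, ρ, h0, hρ, hz, he⟩
  have h1 : ENNReal.ofReal a ≤ 1 := by
    rw [← measure_univ (μ := μ), he]
    simp
  simpa using h1

theorem MemDCone.mono {l r r' : ℝ} {μ : Measure ℝ} (h : MemDCone l r μ) (hr : r ≤ r') :
    MemDCone l r' μ := by
  obtain ⟨a, ha, ρ, h0, hρ, hz, he⟩ := h
  refine ⟨a, ha, ρ, h0, fun x hx y hy hxy => ?_, fun x hx => hz x fun h =>
    hx ⟨h.1, h.2.trans hr⟩, he⟩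
  by_cases hy' : y ∈ Set.Icc l r
  · exact hρ ⟨hx.1, hxy.trans hy'.2⟩ hy' hxy
  · rw [hz y hy']; exact h0 x

theorem MemDCone.integrable {l r : ℝ} {μ : Measure ℝ} [IsFiniteMeasure μ] (hlr : l ≤ r)
    (h : MemDCone l r μ) : Integrable (fun x : ℝ => x) μ := by
  obtain ⟨a, ha, ρ, h0, hρ, hz, he⟩ := h
  have hc : μ (Set.Icc l r)ᶜ = 0 := by
    rw [he]
    simp only [Measure.coe_add, Measure.coe_smul, Pi.add_apply, Pi.smul_apply, smul_eq_mul,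
      add_eq_zero, mul_eq_zero]
    refine ⟨Or.inr ?_, ?_⟩
    · rw [Measure.dirac_apply' _ measurableSet_Icc.compl]
      simp [hlr]
    · rw [withDensity_apply _ measurableSet_Icc.compl, setLIntegral_congr_fun
        measurableSet_Icc.compl (g := fun _ => 0) (fun x hx => by simp [hz x hx])]
      simp
  refine Integrable.of_bound (C := max |l| |r|) (by fun_prop) ?_
  have : ∀ᵐ x ∂μ, x ∈ Set.Icc l r := hc
  filter_upwards [this] with x hx
  exact abs_le_max_abs_abs hx.1 hx.2

theorem memDCone_dirac (l r : ℝ) : MemDCone l r (Measure.dirac l) :=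
  ⟨1, zero_le_one, fun _ => 0, fun _ => le_rfl, fun _ _ _ _ _ => le_rfl, fun _ _ => rfl, by simp⟩

theorem memDCone_restrict (l t : ℝ) :
    MemDCone l t (volume.restrict (Set.Icc l t)) := by
  refine ⟨0, le_rfl, (Set.Icc l t).indicator fun _ => 1,
    fun x => Set.indicator_nonneg (fun _ _ => zero_le_one) x, fun x hx y hy _ => ?_,
    fun x hx => Set.indicator_of_notMem hx _, ?_⟩
  · rw [Set.indicator_of_mem hx, Set.indicator_of_mem hy]
  · have : (fun x => ENNReal.ofReal ((Set.Icc l t).indicator (fun _ => (1 : ℝ)) x))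
        = (Set.Icc l t).indicator 1 := by
      ext x
      by_cases h : x ∈ Set.Icc l t <;> simp [h]
    rw [this, withDensity_indicator_one measurableSet_Icc]
    simp

theorem lam_of_lt {l t : ℝ} (h : l < t) :
    lam l t = ENNReal.ofReal (t - l)⁻¹ • volume.restrict (Set.Icc l t) := by
  rw [lam, if_pos h, ENNReal.ofReal_inv_of_pos (sub_pos.2 h)]

theorem lam_self_s16 (l : ℝ) : lam l l = Measure.dirac l := by
  simp [lam]

instance isProbabilityMeasure_lam (l t : ℝ) : IsProbabilityMeasure (lam l t) := by
  by_cases h : l < t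
  · refine ⟨?_⟩
    rw [lam, if_pos h]
    simp only [Measure.smul_apply, Measure.restrict_apply_univ, Real.volume_Icc, smul_eq_mul]
    exact ENNReal.inv_mul_cancel (by simpa using h) ENNReal.ofReal_ne_top
  · rw [lam, if_neg h]; infer_instance

theorem memDCone_lam (l t : ℝ) : MemDCone l t (lam l t) := by
  by_cases h : l < t
  · rw [lam_of_lt h]
    exact (memDCone_restrict l t).smul (inv_nonneg.2 (sub_nonneg.2 h.le))
  · rw [lam, if_neg h]; exact memDCone_dirac l t

theorem integral_lam {l t : ℝ} (h : l ≤ t) : ∫ x, x ∂(lam l t) = (l + t) / 2 := by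
  rcases h.eq_or_lt with rfl | h
  · rw [lam_self_s16]; simp
  · rw [lam_of_lt h, integral_smul_measure, integral_Icc_eq_integral_Ioc,
      ← intervalIntegral.integral_of_le h.le, integral_id,
      ENNReal.toReal_ofReal (inv_nonneg.2 (sub_nonneg.2 h.le)), smul_eq_mul]
    have : t - l ≠ 0 := (sub_pos.2 h).ne'
    field_simp
    ring

/-- The mixture `a·μ + (1-a)·ν`. -/
noncomputable def mix (a : ℝ) (μ ν : Measure ℝ) : Measure ℝ :=
  ENNReal.ofReal a • μ + ENNReal.ofReal (1 - a) • ν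

section mix

variable {a : ℝ} {μ ν : Measure ℝ}

theorem isProbabilityMeasure_mix [IsProbabilityMeasure μ] [IsProbabilityMeasure ν]
    (h0 : 0 ≤ a) (h1 : a ≤ 1) : IsProbabilityMeasure (mix a μ ν) := by
  refine ⟨?_⟩
  simp only [mix, Measure.coe_add, Measure.coe_smul, Pi.add_apply, Pi.smul_apply, measure_univ,
    smul_eq_mul, mul_one]
  rw [← ENNReal.ofReal_add h0 (sub_nonneg.2 h1)]
  simp

theorem memDCone_mix {l r : ℝ} (hμ : MemDCone l r μ) (hν : MemDCone l r ν)
    (h0 : 0 ≤ a) (h1 : a ≤ 1) : MemDCone l r (mix a μ ν) :=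
  (hμ.smul h0).add (hν.smul (sub_nonneg.2 h1))

theorem integral_mix (hμ : Integrable (fun x : ℝ => x) μ) (hν : Integrable (fun x : ℝ => x) ν)
    (h0 : 0 ≤ a) (h1 : a ≤ 1) :
    ∫ x, x ∂(mix a μ ν) = a * ∫ x, x ∂μ + (1 - a) * ∫ x, x ∂ν := by
  rw [mix, integral_add_measure (hμ.smul_measure ENNReal.ofReal_ne_top)
    (hν.smul_measure ENNReal.ofReal_ne_top), integral_smul_measure, integral_smul_measure,
    ENNReal.toReal_ofReal h0, ENNReal.toReal_ofReal (sub_nonneg.2 h1), smul_eq_mul, smul_eq_mul]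

theorem mix_real [IsFiniteMeasure μ] [IsFiniteMeasure ν] (h0 : 0 ≤ a) (h1 : a ≤ 1)
    (s : Set ℝ) : (mix a μ ν).real s = a * μ.real s + (1 - a) * ν.real s := by
  have := μ.smul_finite (c := ENNReal.ofReal a) ENNReal.ofReal_ne_top
  have := ν.smul_finite (c := ENNReal.ofReal (1 - a)) ENNReal.ofReal_ne_top
  rw [mix, measureReal_add_apply, measureReal_ennreal_smul_apply,
    measureReal_ennreal_smul_apply, ENNReal.toReal_ofReal h0,
    ENNReal.toReal_ofReal (sub_nonneg.2 h1)]

end mix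

theorem eq_of_real_eq {μ ν : Measure ℝ} [IsFiniteMeasure μ] [IsFiniteMeasure ν]
    (h : ∀ s, MeasurableSet s → μ.real s = ν.real s) : μ = ν := by
  ext s hs
  exact (measureReal_eq_measureReal_iff).1 (h s hs)

theorem lam_real {l t : ℝ} (h : l < t) (s : Set ℝ) :
    (lam l t).real s = (t - l)⁻¹ * (volume.restrict (Set.Icc l t)).real s := by
  rw [lam_of_lt h, measureReal_ennreal_smul_apply,
    ENNReal.toReal_ofReal (inv_nonneg.2 (sub_nonneg.2 h.le))]

theorem restrict_Icc_real_add {l m t : ℝ} (h1 : l ≤ m) (h2 : m ≤ t) (s : Set ℝ) :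
    (volume.restrict (Set.Icc l t)).real s
      = (volume.restrict (Set.Icc l m)).real s + (volume.restrict (Set.Icc m t)).real s := by
  have key : (volume.restrict (Set.Icc l t) : Measure ℝ)
      = volume.restrict (Set.Icc l m) + volume.restrict (Set.Icc m t) := by
    simp only [← restrict_Ioc_eq_restrict_Icc]
    rw [← Set.Ioc_union_Ioc_eq_Ioc h1 h2, Measure.restrict_union
      (Set.Ioc_disjoint_Ioc_of_le le_rfl) measurableSet_Ioc]
  rw [key, measureReal_add_apply]

theorem lam_real_split {l m t : ℝ} (h1 : l ≤ m) (h2 : m ≤ t) (s : Set ℝ) :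
    (t - l) * (lam l t).real s = (m - l) * (lam l m).real s + (t - m) * (lam m t).real s := by
  have key : ∀ {a b : ℝ}, a ≤ b →
      (b - a) * (lam a b).real s = (volume.restrict (Set.Icc a b)).real s := by
    intro a b hab
    rcases hab.eq_or_lt with rfl | hab
    · simp [measureReal_def]
    · rw [lam_real hab, mul_inv_cancel_left₀ (sub_pos.2 hab).ne']
  rw [key h1, key h2, key (h1.trans h2), restrict_Icc_real_add h1 h2]

theorem lam_eq_mix_half {l t : ℝ} (h : l ≤ t) :
    lam l t = mix (1 / 2) (lam l ((l + t) / 2)) (lam ((l + t) / 2) t) := by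
  have := isProbabilityMeasure_mix (a := 1 / 2) (μ := lam l ((l + t) / 2))
    (ν := lam ((l + t) / 2) t) (by norm_num) (by norm_num)
  refine eq_of_real_eq fun s _ => ?_
  rw [mix_real (by norm_num) (by norm_num)]
  rcases h.eq_or_lt with rfl | h
  · simp only [add_self_div_two]; ring
  · have := lam_real_split (l := l) (m := (l + t) / 2) (t := t) (by linarith) (by linarith) s
    have h' : 0 < t - l := sub_pos.2 h
    apply mul_left_cancel₀ h'.ne'
    rw [this]; ring

/-- A uniform measure splits off a uniform measure on a right-hand subinterval, the remainder
having nonincreasing density on the whole interval. -/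
theorem exists_lam_eq_mix {l m t β : ℝ} (h1 : l ≤ m) (h2 : m ≤ t) (hβ : 0 < β) (hβ1 : β < 1)
    (h : β * (t - l) ≤ t - m) :
    ∃ ν : Measure ℝ, IsProbabilityMeasure ν ∧ MemDCone l t ν ∧ lam l t = mix β (lam m t) ν := by
  rcases h2.eq_or_lt with rfl | h2
  · have : m - l = 0 := by nlinarith
    obtain rfl : m = l := by linarith
    refine ⟨lam m m, inferInstance, memDCone_lam m m, ?_⟩
    have := isProbabilityMeasure_mix (a := β) (μ := lam m m) (ν := lam m m) hβ.le hβ1.le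
    refine eq_of_real_eq fun s _ => ?_
    rw [mix_real hβ.le hβ1.le]; ring
  · have htm : 0 < t - m := sub_pos.2 h2
    have hβ' : 0 < 1 - β := sub_pos.2 hβ1
    have hq0 : 0 ≤ β * (m - l) / ((t - m) * (1 - β)) := by
      have : 0 ≤ m - l := sub_nonneg.2 h1
      positivity
    have hq1 : β * (m - l) / ((t - m) * (1 - β)) ≤ 1 := by
      rw [div_le_one (by positivity)]; nlinarith
    have hp := isProbabilityMeasure_mix (μ := lam l m) (ν := lam l t) hq0 hq1
    refine ⟨_, hp, memDCone_mix ((memDCone_lam l m).mono h2.le) (memDCone_lam l t) hq0 hq1, ?_⟩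
    have := isProbabilityMeasure_mix (μ := lam m t)
      (ν := mix (β * (m - l) / ((t - m) * (1 - β))) (lam l m) (lam l t)) hβ.le hβ1.le
    refine eq_of_real_eq fun s _ => ?_
    rw [mix_real hβ.le hβ1.le, mix_real hq0 hq1]
    have := lam_real_split h1 h2.le s
    have e : (lam m t).real s
        = ((t - l) * (lam l t).real s - (m - l) * (lam l m).real s) / (t - m) := by
      rw [this]; field_simp; ring
    rw [e]
    field_simp
    ring

/-- `μ` has no nontrivial decomposition as a convex combination within `V^N[C]`. -/
def Indecomposable {N : ℕ} (C : ℝ) (μ : Fin N → Measure ℝ) : Prop :=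
  ∀ (μ₁ μ₂ : Fin N → Measure ℝ),
    (∀ k, IsProbabilityMeasure (μ₁ k)) → (∀ k, IsProbabilityMeasure (μ₂ k)) →
    memV C μ₁ → memV C μ₂ → ∀ α : ℝ, 0 < α → α < 1 →
    (∀ k, μ k = ENNReal.ofReal α • μ₁ k + ENNReal.ofReal (1 - α) • μ₂ k) →
    μ₁ = μ₂

theorem mix_self {a : ℝ} {μ : Measure ℝ} (h0 : 0 ≤ a) (h1 : a ≤ 1) : mix a μ μ = μ := by
  rw [mix, ← add_smul, ← ENNReal.ofReal_add h0 (sub_nonneg.2 h1)]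
  simp

theorem Indecomposable.eq_left {N : ℕ} {C : ℝ} {μ A B : Fin N → Measure ℝ}
    (hμ : Indecomposable C μ) (hC : ∑ k, ∫ x, x ∂(μ k) = C)
    (pA : ∀ k, IsProbabilityMeasure (A k)) (pB : ∀ k, IsProbabilityMeasure (B k))
    {lA rA lB rB : Fin N → ℝ} (cA : CompatBoundary C lA rA) (cB : CompatBoundary C lB rB)
    (dA : ∀ k, MemDCone (lA k) (rA k) (A k)) (dB : ∀ k, MemDCone (lB k) (rB k) (B k))
    (mA : ∑ k, ∫ x, x ∂(A k) = C) {β : ℝ} (h0 : 0 < β) (h1 : β < 1)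
    (h : ∀ k, μ k = mix β (A k) (B k)) : A = μ := by
  have hm : ∀ k, ∫ x, x ∂(μ k) = β * ∫ x, x ∂(A k) + (1 - β) * ∫ x, x ∂(B k) := fun k => by
    rw [h k, integral_mix ((dA k).integrable (sub_nonneg.1 (cA k).1))
      ((dB k).integrable (sub_nonneg.1 (cB k).1)) h0.le h1.le]
  have mB : ∑ k, ∫ x, x ∂(B k) = C := by
    have h2 : C = β * C + (1 - β) * ∑ k, ∫ x, x ∂(B k) := by
      conv_lhs => rw [← hC]
      simp_rw [hm]
      rw [Finset.sum_add_distrib, ← Finset.mul_sum, ← Finset.mul_sum, mA]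
    have h3 : (1 - β) * (∑ k, ∫ x, x ∂(B k) - C) = 0 := by linarith
    rcases mul_eq_zero.1 h3 with h3 | h3 <;> linarith
  have hAB := hμ A B pA pB ⟨mA, lA, rA, cA, fun k => (dA k).memD⟩
    ⟨mB, lB, rB, cB, fun k => (dB k).memD⟩ β h0 h1 h
  funext k
  rw [h k, ← hAB, mix_self h0.le h1.le]

theorem Indecomposable.eq_left_single {N : ℕ} {C : ℝ} {μ : Fin N → Measure ℝ}
    (hμ : Indecomposable C μ) (hC : ∑ k, ∫ x, x ∂(μ k) = C)
    (hp : ∀ k, IsProbabilityMeasure (μ k)) {l r : Fin N → ℝ} (hc : CompatBoundary C l r)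
    (hd : ∀ k, MemDCone (l k) (r k) (μ k)) (k : Fin N) {ν ν' : Measure ℝ}
    [pν : IsProbabilityMeasure ν] [pν' : IsProbabilityMeasure ν'] (dν : MemDCone (l k) (r k) ν)
    (dν' : MemDCone (l k) (r k) ν') (hE : ∫ x, x ∂ν = ∫ x, x ∂(μ k)) {β : ℝ} (h0 : 0 < β)
    (h1 : β < 1) (h : μ k = mix β ν ν') : ν = μ k := by
  have key : ∀ (P : Fin N → Measure ℝ → Prop) (σ : Measure ℝ), (∀ j, P j (μ j)) → P k σ →
      ∀ j, P j (Function.update μ k σ j) := by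
    intro P σ hj hk j
    rcases eq_or_ne j k with rfl | hjk
    · simpa using hk
    · simpa [hjk] using hj j
  have := hμ.eq_left hC (A := Function.update μ k ν) (B := Function.update μ k ν')
    (key (fun _ σ => IsProbabilityMeasure σ) ν hp pν)
    (key (fun _ σ => IsProbabilityMeasure σ) ν' hp pν') hc hc
    (key (fun j σ => MemDCone (l j) (r j) σ) ν hd dν)
    (key (fun j σ => MemDCone (l j) (r j) σ) ν' hd dν')
    (by
      rw [← hC]
      exact Finset.sum_congr rfl fun j _ =>
        key (fun j σ => ∫ x, x ∂σ = ∫ x, x ∂(μ j)) ν (fun _ => rfl) hE j) h0 h1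
    (fun j => by
      rcases eq_or_ne j k with rfl | hjk
      · simpa using h
      · simp [hjk, mix_self h0.le h1.le])
  simpa using congrFun this k

theorem exists_ne_zero_of_two_linear_eq {m₁ m₂ m₃ e₁ e₂ e₃ : ℝ} (h : m₁ ≠ 0) :
    ∃ t₁ t₂ t₃ : ℝ, ¬ (t₁ = 0 ∧ t₂ = 0 ∧ t₃ = 0) ∧
      t₁ * m₁ + t₂ * m₂ + t₃ * m₃ = 0 ∧ t₁ * e₁ + t₂ * e₂ + t₃ * e₃ = 0 := by
  by_cases hd : m₁ * e₂ - m₂ * e₁ = 0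
  · exact ⟨m₂, -m₁, 0, by simp [h], by ring, by linarith⟩
  · exact ⟨m₂ * e₃ - m₃ * e₂, m₃ * e₁ - m₁ * e₃, m₁ * e₂ - m₂ * e₁, fun h' => hd h'.2.2,
      by ring, by ring⟩

/-- The combination `c₁·M₁ + c₂·M₂ + c₃·M₃`. -/
noncomputable def comb (c₁ c₂ c₃ : ℝ) (M₁ M₂ M₃ : Measure ℝ) : Measure ℝ :=
  ENNReal.ofReal c₁ • M₁ + ENNReal.ofReal c₂ • M₂ + ENNReal.ofReal c₃ • M₃

section comb

variable {c₁ c₂ c₃ : ℝ} {M₁ M₂ M₃ : Measure ℝ}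

theorem isFiniteMeasure_comb [IsFiniteMeasure M₁] [IsFiniteMeasure M₂] [IsFiniteMeasure M₃] :
    IsFiniteMeasure (comb c₁ c₂ c₃ M₁ M₂ M₃) := by
  have := M₁.smul_finite (c := ENNReal.ofReal c₁) ENNReal.ofReal_ne_top
  have := M₂.smul_finite (c := ENNReal.ofReal c₂) ENNReal.ofReal_ne_top
  have := M₃.smul_finite (c := ENNReal.ofReal c₃) ENNReal.ofReal_ne_top
  unfold comb; infer_instance

theorem comb_real [IsFiniteMeasure M₁] [IsFiniteMeasure M₂] [IsFiniteMeasure M₃] (h₁ : 0 ≤ c₁)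
    (h₂ : 0 ≤ c₂) (h₃ : 0 ≤ c₃) (s : Set ℝ) : (comb c₁ c₂ c₃ M₁ M₂ M₃).real s
      = c₁ * M₁.real s + c₂ * M₂.real s + c₃ * M₃.real s := by
  have := M₁.smul_finite (c := ENNReal.ofReal c₁) ENNReal.ofReal_ne_top
  have := M₂.smul_finite (c := ENNReal.ofReal c₂) ENNReal.ofReal_ne_top
  have := M₃.smul_finite (c := ENNReal.ofReal c₃) ENNReal.ofReal_ne_top
  rw [comb, measureReal_add_apply, measureReal_add_apply, measureReal_ennreal_smul_apply,
    measureReal_ennreal_smul_apply, measureReal_ennreal_smul_apply, ENNReal.toReal_ofReal h₁,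
    ENNReal.toReal_ofReal h₂, ENNReal.toReal_ofReal h₃]

theorem integral_comb (i₁ : Integrable (fun x : ℝ => x) M₁) (i₂ : Integrable (fun x : ℝ => x) M₂)
    (i₃ : Integrable (fun x : ℝ => x) M₃) (h₁ : 0 ≤ c₁) (h₂ : 0 ≤ c₂) (h₃ : 0 ≤ c₃) :
    ∫ x, x ∂(comb c₁ c₂ c₃ M₁ M₂ M₃)
      = c₁ * ∫ x, x ∂M₁ + c₂ * ∫ x, x ∂M₂ + c₃ * ∫ x, x ∂M₃ := by
  have j₁ := i₁.smul_measure (c := ENNReal.ofReal c₁) ENNReal.ofReal_ne_top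
  have j₂ := i₂.smul_measure (c := ENNReal.ofReal c₂) ENNReal.ofReal_ne_top
  have j₃ := i₃.smul_measure (c := ENNReal.ofReal c₃) ENNReal.ofReal_ne_top
  rw [comb, integral_add_measure (j₁.add_measure j₂) j₃, integral_add_measure j₁ j₂,
    integral_smul_measure, integral_smul_measure, integral_smul_measure,
    ENNReal.toReal_ofReal h₁, ENNReal.toReal_ofReal h₂, ENNReal.toReal_ofReal h₃]
  simp only [smul_eq_mul]

theorem memDCone_comb {l r : ℝ} (d₁ : MemDCone l r M₁) (d₂ : MemDCone l r M₂)
    (d₃ : MemDCone l r M₃) (h₁ : 0 ≤ c₁) (h₂ : 0 ≤ c₂) (h₃ : 0 ≤ c₃) :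
    MemDCone l r (comb c₁ c₂ c₃ M₁ M₂ M₃) :=
  ((d₁.smul h₁).add (d₂.smul h₂)).add (d₃.smul h₃)

end comb

/-- No coordinate of an indecomposable tuple is a sum of three linearly independent elements of
the cone. -/
theorem Indecomposable.ne_add_three {N : ℕ} {C : ℝ} {μ : Fin N → Measure ℝ}
    (hμ : Indecomposable C μ) (hC : ∑ k, ∫ x, x ∂(μ k) = C)
    (hp : ∀ k, IsProbabilityMeasure (μ k)) {l r : Fin N → ℝ} (hc : CompatBoundary C l r)
    (hd : ∀ k, MemDCone (l k) (r k) (μ k)) (k : Fin N) {M₁ M₂ M₃ : Measure ℝ}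
    (d₁ : MemDCone (l k) (r k) M₁) (d₂ : MemDCone (l k) (r k) M₂)
    (d₃ : MemDCone (l k) (r k) M₃) {I J : Set ℝ}
    (hI₁ : M₁ I = 0) (hI₂ : M₂ I = 0) (hI₃ : M₃ I ≠ 0) (hJ₁ : M₁ J = 0) (hJ₂ : M₂ J ≠ 0)
    (h₁ : M₁ Set.univ ≠ 0) : μ k ≠ M₁ + M₂ + M₃ := by
  intro h
  have f₁ : IsFiniteMeasure M₁ := isFiniteMeasure_of_le (μ k) (by
    rw [h, add_assoc]; exact Measure.le_add_right le_rfl)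
  have f₂ : IsFiniteMeasure M₂ := isFiniteMeasure_of_le (μ k) (by
    rw [h, add_comm M₁, add_assoc]; exact Measure.le_add_right le_rfl)
  have f₃ : IsFiniteMeasure M₃ := isFiniteMeasure_of_le (μ k) (by
    rw [h]; exact Measure.le_add_left le_rfl)
  have hlr := sub_nonneg.1 (hc k).1
  have hu : μ k = comb 1 1 1 M₁ M₂ M₃ := by simpa [comb] using h
  have m₁ : M₁.real Set.univ ≠ 0 := by rwa [Ne, measureReal_eq_zero_iff]
  obtain ⟨t₁, t₂, t₃, hne, hm, he⟩ := exists_ne_zero_of_two_linear_eq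
    (m₂ := M₂.real Set.univ) (m₃ := M₃.real Set.univ) (e₁ := ∫ x, x ∂M₁) (e₂ := ∫ x, x ∂M₂)
    (e₃ := ∫ x, x ∂M₃) m₁
  obtain ⟨ε, hε, b₁, b₂, b₃⟩ : ∃ ε : ℝ, 0 < ε ∧ |ε * t₁| ≤ 1 ∧ |ε * t₂| ≤ 1 ∧ |ε * t₃| ≤ 1 := by
    have hpos : 0 < |t₁| + |t₂| + |t₃| + 1 := by positivity
    refine ⟨(|t₁| + |t₂| + |t₃| + 1)⁻¹, by positivity, ?_, ?_, ?_⟩ <;>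
    · rw [abs_mul, abs_of_pos (inv_pos.2 hpos), inv_mul_le_one₀ hpos]
      linarith [abs_nonneg t₁, abs_nonneg t₂, abs_nonneg t₃]
  rw [abs_le] at b₁ b₂ b₃
  have pos : ∀ c : ℝ, c = 1 ∨ c = -1 →
      0 ≤ 1 + c * (ε * t₁) ∧ 0 ≤ 1 + c * (ε * t₂) ∧ 0 ≤ 1 + c * (ε * t₃) := by
    rintro c (rfl | rfl) <;> refine ⟨?_, ?_, ?_⟩ <;> linarith
  have huniv := congrArg (fun σ => Measure.real σ Set.univ) hu
  simp only [comb_real zero_le_one zero_le_one zero_le_one, probReal_univ] at huniv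
  have prob : ∀ c : ℝ, c = 1 ∨ c = -1 → IsProbabilityMeasure
      (comb (1 + c * (ε * t₁)) (1 + c * (ε * t₂)) (1 + c * (ε * t₃)) M₁ M₂ M₃) := by
    intro c h
    obtain ⟨p₁, p₂, p₃⟩ := pos c h
    have := isFiniteMeasure_comb (c₁ := 1 + c * (ε * t₁)) (c₂ := 1 + c * (ε * t₂))
      (c₃ := 1 + c * (ε * t₃)) (M₁ := M₁) (M₂ := M₂) (M₃ := M₃)
    rw [isProbabilityMeasure_iff_real, comb_real p₁ p₂ p₃]
    linear_combination (c * ε) * hm - huniv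
  have cone : ∀ c : ℝ, c = 1 ∨ c = -1 → MemDCone (l k) (r k)
      (comb (1 + c * (ε * t₁)) (1 + c * (ε * t₂)) (1 + c * (ε * t₃)) M₁ M₂ M₃) := fun c h =>
    memDCone_comb d₁ d₂ d₃ (pos c h).1 (pos c h).2.1 (pos c h).2.2
  have pA := prob 1 (Or.inl rfl)
  have pB := prob (-1) (Or.inr rfl)
  obtain ⟨p₁, p₂, p₃⟩ := pos 1 (Or.inl rfl)
  obtain ⟨q₁, q₂, q₃⟩ := pos (-1) (Or.inr rfl)
  have hmix : μ k = mix (1 / 2) (comb (1 + 1 * (ε * t₁)) (1 + 1 * (ε * t₂)) (1 + 1 * (ε * t₃))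
      M₁ M₂ M₃) (comb (1 + -1 * (ε * t₁)) (1 + -1 * (ε * t₂)) (1 + -1 * (ε * t₃)) M₁ M₂ M₃) := by
    have := hp k
    have := isProbabilityMeasure_mix (a := 1 / 2)
      (μ := comb (1 + 1 * (ε * t₁)) (1 + 1 * (ε * t₂)) (1 + 1 * (ε * t₃)) M₁ M₂ M₃)
      (ν := comb (1 + -1 * (ε * t₁)) (1 + -1 * (ε * t₂)) (1 + -1 * (ε * t₃)) M₁ M₂ M₃)
      (by norm_num) (by norm_num)
    refine eq_of_real_eq fun s _ => ?_
    rw [mix_real (by norm_num) (by norm_num), comb_real p₁ p₂ p₃, comb_real q₁ q₂ q₃, hu,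
      comb_real zero_le_one zero_le_one zero_le_one]
    ring
  have hEq := hμ.eq_left_single hC hp hc hd k (cone 1 (Or.inl rfl)) (cone (-1) (Or.inr rfl))
    (by
      rw [hu, integral_comb (d₁.integrable hlr) (d₂.integrable hlr) (d₃.integrable hlr) p₁ p₂ p₃,
        integral_comb (d₁.integrable hlr) (d₂.integrable hlr) (d₃.integrable hlr) zero_le_one
          zero_le_one zero_le_one]
      linear_combination ε * he) (by norm_num) (by norm_num) hmix
  have hs : ∀ s, t₁ * M₁.real s + t₂ * M₂.real s + t₃ * M₃.real s = 0 := by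
    intro s
    have := congrArg (fun σ => Measure.real σ s) hEq
    simp only [hu, comb_real p₁ p₂ p₃, comb_real zero_le_one zero_le_one zero_le_one] at this
    have h' : ε * (t₁ * M₁.real s + t₂ * M₂.real s + t₃ * M₃.real s) = 0 := by linarith
    exact (mul_eq_zero.1 h').resolve_left hε.ne'
  have t₃0 : t₃ = 0 := by
    have := hs I
    rw [(measureReal_eq_zero_iff).2 hI₁, (measureReal_eq_zero_iff).2 hI₂] at this
    have h3 : M₃.real I ≠ 0 := by rwa [Ne, measureReal_eq_zero_iff]
    simpa [h3] using this
  have t₂0 : t₂ = 0 := by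
    have := hs J
    rw [(measureReal_eq_zero_iff).2 hJ₁, t₃0] at this
    have h3 : M₂.real J ≠ 0 := by rwa [Ne, measureReal_eq_zero_iff]
    simpa [h3] using this
  have t₁0 : t₁ = 0 := by
    have := hs Set.univ
    rw [t₃0, t₂0] at this
    simpa [m₁] using this
  exact hne ⟨t₁0, t₂0, t₃0⟩

/-- A nonnegative density supported on `[l,r]` and nonincreasing there. -/
structure IsDens (l r : ℝ) (ρ : ℝ → ℝ) : Prop where
  nonneg : ∀ x, 0 ≤ ρ x
  antitone : AntitoneOn ρ (Set.Icc l r)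
  zero : ∀ x ∉ Set.Icc l r, ρ x = 0

/-- The measure with density `ρ`. -/
noncomputable def wd (ρ : ℝ → ℝ) : Measure ℝ :=
  volume.withDensity fun x => ENNReal.ofReal (ρ x)

section IsDens

variable {l r : ℝ} {ρ : ℝ → ℝ}

theorem IsDens.measurable (h : IsDens l r ρ) : Measurable ρ :=
  measurable_of_antitoneOn_Icc h.nonneg h.antitone h.zero

theorem IsDens.memDCone (h : IsDens l r ρ) : MemDCone l r (wd ρ) :=
  ⟨0, le_rfl, ρ, h.nonneg, h.antitone, h.zero, by simp [wd]⟩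

theorem IsDens.posPart (h : IsDens l r ρ) {c : ℝ} (hc : 0 ≤ c) :
    IsDens l r fun x => max (ρ x - c) 0 where
  nonneg _ := le_max_right _ _
  antitone _ hx _ hy hxy := max_le_max_right _ (sub_le_sub_right (h.antitone hx hy hxy) _)
  zero x hx := by rw [h.zero x hx]; simpa using hc

theorem IsDens.min (h : IsDens l r ρ) {c : ℝ} (hc : 0 ≤ c) :
    IsDens l r fun x => Min.min (ρ x) c where
  nonneg x := le_min (h.nonneg x) hc
  antitone _ hx _ hy hxy := min_le_min_right _ (h.antitone hx hy hxy)
  zero x hx := by rw [h.zero x hx]; simpa using hc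

theorem wd_add {σ τ : ℝ → ℝ} (hσ : Measurable σ) (h0 : ∀ x, 0 ≤ σ x) (h1 : ∀ x, 0 ≤ τ x) :
    wd (fun x => σ x + τ x) = wd σ + wd τ := by
  rw [wd, wd, wd, ← withDensity_add_left hσ.ennreal_ofReal]
  congr 1
  ext x
  simp [ENNReal.ofReal_add (h0 x) (h1 x)]

theorem IsDens.wd_split (h : IsDens l r ρ) {c : ℝ} (hc : 0 ≤ c) :
    wd ρ = wd (fun x => max (ρ x - c) 0) + wd fun x => Min.min (ρ x) c := by
  rw [← wd_add (h.posPart hc).measurable (h.posPart hc).nonneg (h.min hc).nonneg]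
  congr 1
  ext x
  rcases le_total (ρ x) c with h | h
  · rw [max_eq_right (by linarith), min_eq_left h]; ring
  · rw [max_eq_left (by linarith), min_eq_right h]; ring

theorem wd_eq_zero {s : Set ℝ} (hs : MeasurableSet s) (h : ∀ x ∈ s, ρ x = 0) : wd ρ s = 0 := by
  rw [wd, withDensity_apply _ hs, setLIntegral_congr_fun hs (g := fun _ => 0)
    fun x hx => by simp [h x hx]]
  simp

theorem wd_Ioo_ne_zero (hρ : Measurable ρ) {a b : ℝ} (hab : a < b)
    (h : ∀ x ∈ Set.Ioo a b, 0 < ρ x) : wd ρ (Set.Ioo a b) ≠ 0 := by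
  rw [wd, Ne, withDensity_apply_eq_zero hρ.ennreal_ofReal]
  have : {x | ENNReal.ofReal (ρ x) ≠ 0} ∩ Set.Ioo a b = Set.Ioo a b := by
    ext x
    simp only [ne_eq, ENNReal.ofReal_eq_zero, not_le, Set.mem_inter_iff, Set.mem_ofPred_eq,
      and_iff_right_iff_imp]
    exact h x
  rw [this]
  simpa using hab

theorem wd_congr {σ : ℝ → ℝ} (h : ρ =ᵐ[volume] σ) : wd ρ = wd σ := by
  refine withDensity_congr_ae ?_
  filter_upwards [h] with x hx
  rw [hx]

theorem wd_indicator {c : ℝ} {s : Set ℝ} (hs : MeasurableSet s) :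
    wd (s.indicator fun _ => c) = ENNReal.ofReal c • volume.restrict s := by
  have : (fun x => ENNReal.ofReal (s.indicator (fun _ => c) x))
      = s.indicator fun _ => ENNReal.ofReal c := by
    ext x
    by_cases h : x ∈ s <;> simp [h]
  rw [wd, this, withDensity_indicator hs, withDensity_const]

/-- The right endpoint can be shrunk so that the density is positive in the interior. -/
theorem IsDens.exists_pos (h : IsDens l r ρ) (hlr : l ≤ r) :
    ∃ r', l ≤ r' ∧ r' ≤ r ∧ IsDens l r' ρ ∧ ∀ x ∈ Set.Ioo l r', 0 < ρ x := by
  set S : Set ℝ := insert l {x | x ∈ Set.Icc l r ∧ 0 < ρ x} with hS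
  have hbdd : BddAbove S := ⟨r, by rintro x (rfl | hx); exacts [hlr, hx.1.2]⟩
  have hne : S.Nonempty := ⟨l, Or.inl rfl⟩
  have hlS : l ≤ sSup S := le_csSup hbdd (Or.inl rfl)
  have hSr : sSup S ≤ r := csSup_le hne (by rintro x (rfl | hx); exacts [hlr, hx.1.2])
  refine ⟨sSup S, hlS, hSr, ⟨h.nonneg, h.antitone.mono (Set.Icc_subset_Icc_right hSr),
    fun x hx => ?_⟩, fun x hx => ?_⟩
  · by_contra hne'
    have hx' : x ∈ Set.Icc l r := by
      by_contra h'; exact hne' (h.zero x h')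
    exact hx ⟨hx'.1, le_csSup hbdd (Or.inr ⟨hx', lt_of_le_of_ne (h.nonneg x) (Ne.symm hne')⟩)⟩
  · obtain ⟨y, hy, hxy⟩ := exists_lt_of_lt_csSup hne hx.2
    rcases hy with rfl | hy
    · exact absurd hx.1 hxy.le.not_gt
    · exact hy.2.trans_le (h.antitone ⟨hx.1.le, hxy.le.trans hy.1.2⟩ hy.1 hxy.le)

/-- An antitone function either takes three values robustly, or is a step function with at most
two steps. -/
theorem exists_four_or_step (hlr : l < r) (hρ : AntitoneOn ρ (Set.Ioo l r)) :
    (∃ x y₁ y₂ z, l < x ∧ x < y₁ ∧ y₁ < y₂ ∧ y₂ < z ∧ z < r ∧ ρ y₁ < ρ x ∧ ρ z < ρ y₂) ∨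
    ∃ s a b, l ≤ s ∧ s ≤ r ∧ (∀ x ∈ Set.Ioo l s, ρ x = a) ∧ (∀ x ∈ Set.Ioo s r, ρ x = b) := by
  refine or_iff_not_imp_left.2 fun hno => ?_
  push Not at hno
  set W : Set ℝ := insert r {w | w < r ∧ ∃ x, l < x ∧ x < w ∧ ρ w < ρ x} with hW
  have hlow : ∀ w ∈ W, l ≤ w := by
    rintro w (rfl | ⟨-, x, h1, h2, -⟩)
    exacts [hlr.le, (h1.trans h2).le]
  have hbdd : BddBelow W := ⟨l, hlow⟩
  have hne : W.Nonempty := ⟨r, Or.inl rfl⟩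
  have hsr : sInf W ≤ r := csInf_le hbdd (Or.inl rfl)
  have hls : l ≤ sInf W := le_csInf hne hlow
  have c1 : ∀ x ∈ Set.Ioo l (sInf W), ∀ y ∈ Set.Ioo l (sInf W), x < y → ρ x = ρ y := by
    intro x hx y hy hxy
    by_contra hne'
    have hyr := hy.2.trans_le hsr
    have := lt_of_le_of_ne (hρ ⟨hx.1, hxy.trans hyr⟩ ⟨hy.1, hyr⟩ hxy.le) (Ne.symm hne')
    exact absurd (csInf_le hbdd (Or.inr ⟨hyr, x, hx.1, hxy, this⟩)) hy.2.not_ge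
  have c2 : ∀ x ∈ Set.Ioo (sInf W) r, ∀ y ∈ Set.Ioo (sInf W) r, x < y → ρ x = ρ y := by
    intro x hx y hy hxy
    obtain ⟨w, hw, hwx⟩ := exists_lt_of_csInf_lt hne hx.1
    rcases hw with rfl | ⟨-, v, hv1, hv2, hv3⟩
    · exact absurd hx.2 hwx.not_gt
    · exact le_antisymm (hno v w x y hv1 hv2 hwx hxy hy.2 hv3)
        (hρ ⟨hls.trans_lt hx.1, hx.2⟩ ⟨hls.trans_lt hy.1, hy.2⟩ hxy.le)
  have const : ∀ S : Set ℝ, (∀ x ∈ S, ∀ y ∈ S, x < y → ρ x = ρ y) → ∃ a, ∀ x ∈ S, ρ x = a := by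
    intro S hS
    rcases S.eq_empty_or_nonempty with rfl | ⟨p, hp⟩
    · exact ⟨0, by simp⟩
    · refine ⟨ρ p, fun x hx => ?_⟩
      rcases lt_trichotomy x p with h | rfl | h
      exacts [hS x hx p hp h, rfl, (hS p hp x hx h).symm]
  obtain ⟨a, ha⟩ := const _ c1
  obtain ⟨b, hb⟩ := const _ c2
  exact ⟨sInf W, a, b, hls, hsr, ha, hb⟩

theorem IsDens.wd_eq_of_step (h : IsDens l r ρ) (hlr : l < r)
    (hpos : ∀ x ∈ Set.Ioo l r, 0 < ρ x) {s a b : ℝ} (hls : l ≤ s) (hsr : s ≤ r)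
    (ha : ∀ x ∈ Set.Ioo l s, ρ x = a) (hb : ∀ x ∈ Set.Ioo s r, ρ x = b) :
    ∃ s u v, l ≤ s ∧ s < r ∧ 0 ≤ u ∧ 0 < v ∧ (0 < u → l < s) ∧
      wd ρ = ENNReal.ofReal u • volume.restrict (Set.Icc l s)
        + ENNReal.ofReal v • volume.restrict (Set.Icc l r) := by
  have key : ∀ s u v, l ≤ s → s < r → 0 ≤ u → 0 < v → (∀ x ∈ Set.Ioo l s, ρ x = u + v) →
      (∀ x ∈ Set.Ioo s r, ρ x = v) →
      wd ρ = ENNReal.ofReal u • volume.restrict (Set.Icc l s)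
        + ENNReal.ofReal v • volume.restrict (Set.Icc l r) := by
    intro s u v hls hsr hu hv h1 h2
    rw [← wd_indicator measurableSet_Icc, ← wd_indicator measurableSet_Icc, ← wd_add
      (measurable_const.indicator measurableSet_Icc)
      (fun x => Set.indicator_nonneg (fun _ _ => hu) x)
      (fun x => Set.indicator_nonneg (fun _ _ => hv.le) x)]
    refine wd_congr ?_
    have hnull : ∀ p : ℝ, ∀ᵐ x, x ≠ p := fun p => by simp [ae_iff]
    filter_upwards [hnull l, hnull s, hnull r] with x xl xs xr
    rcases lt_or_gt_of_ne xl with h' | hl'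
    · rw [h.zero x fun hx => h'.not_ge hx.1,
        Set.indicator_of_notMem fun hx => h'.not_ge hx.1,
        Set.indicator_of_notMem fun hx => h'.not_ge hx.1, add_zero]
    rcases lt_or_gt_of_ne xs with hs' | hs'
    · rw [h1 x ⟨hl', hs'⟩, Set.indicator_of_mem (Set.mem_Icc.2 ⟨hl'.le, hs'.le⟩),
        Set.indicator_of_mem (Set.mem_Icc.2 ⟨hl'.le, hs'.le.trans hsr.le⟩)]
    rw [Set.indicator_of_notMem fun hx => hs'.not_ge hx.2, zero_add]
    rcases lt_or_gt_of_ne xr with hr' | hr'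
    · rw [h2 x ⟨hs', hr'⟩, Set.indicator_of_mem (Set.mem_Icc.2 ⟨hl'.le, hr'.le⟩)]
    · rw [h.zero x fun hx => hr'.not_ge hx.2, Set.indicator_of_notMem fun hx => hr'.not_ge hx.2]
  rcases hls.eq_or_lt with rfl | hls
  · have hb0 : 0 < b := by
      obtain ⟨x, hx⟩ := exists_between hlr
      rw [← hb x hx]; exact hpos x hx
    exact ⟨l, 0, b, le_rfl, hlr, le_rfl, hb0, fun h => absurd h (lt_irrefl _),
      key l 0 b le_rfl hlr le_rfl hb0 (by simp) hb⟩
  rcases hsr.eq_or_lt with rfl | hsr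
  · have ha0 : 0 < a := by
      obtain ⟨x, hx⟩ := exists_between hlr
      rw [← ha x hx]; exact hpos x hx
    exact ⟨l, 0, a, le_rfl, hlr, le_rfl, ha0, fun h => absurd h (lt_irrefl _),
      key l 0 a le_rfl hlr le_rfl ha0 (by simp) ha⟩
  obtain ⟨x, hx⟩ := exists_between hls
  obtain ⟨y, hy⟩ := exists_between hsr
  have hb0 : 0 < b := by
    rw [← hb y hy]; exact hpos y ⟨hls.trans hy.1, hy.2⟩
  have hab : b ≤ a := by
    rw [← hb y hy, ← ha x hx]
    exact h.antitone ⟨hx.1.le, (hx.2.trans hsr).le⟩ ⟨(hls.trans hy.1).le, hy.2.le⟩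
      (hx.2.trans hy.1).le
  exact ⟨s, a - b, b, hls.le, hsr, sub_nonneg.2 hab, hb0, fun _ => hls,
    key s (a - b) b hls.le hsr (sub_nonneg.2 hab) hb0 (by simpa using ha) hb⟩

end IsDens

theorem restrict_Icc_eq_smul_lam {l t : ℝ} (h : l < t) :
    volume.restrict (Set.Icc l t) = ENNReal.ofReal (t - l) • lam l t := by
  have h' : 0 < t - l := sub_pos.2 h
  rw [lam_of_lt h, smul_smul, ← ENNReal.ofReal_mul h'.le, mul_inv_cancel₀ h'.ne']
  simp

theorem MemDCone.mono_left_restrict {l s r c : ℝ} (hs : s ≤ r) (hc : 0 ≤ c) :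
    MemDCone l r (ENNReal.ofReal c • volume.restrict (Set.Icc l s)) :=
  ((memDCone_restrict l s).mono hs).smul hc

theorem smul_restrict_Ioo_ne_zero {a b x y c : ℝ} (hc : 0 < c) (hab : a < b)
    (h1 : x ≤ a) (h2 : b ≤ y) :
    (ENNReal.ofReal c • volume.restrict (Set.Icc x y)) (Set.Ioo a b) ≠ 0 := by
  rw [Measure.smul_apply, Measure.restrict_apply measurableSet_Ioo, Set.inter_eq_left.2
    (Set.Ioo_subset_Icc_self.trans (Set.Icc_subset_Icc h1 h2))]
  simp [hc, hab]

theorem smul_dirac_Ioo {l a b : ℝ} (c : ENNReal) (h : l ≤ a) :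
    (c • Measure.dirac l : Measure ℝ) (Set.Ioo a b) = 0 := by
  rw [Measure.smul_apply, Measure.dirac_apply' _ measurableSet_Ioo]
  simp [h]

/-- Each coordinate of an indecomposable tuple is uniform or a mixture of two uniforms. -/
theorem Indecomposable.uniform_or_mix {N : ℕ} {C : ℝ} {μ : Fin N → Measure ℝ}
    (hμ : Indecomposable C μ) (hC : ∑ k, ∫ x, x ∂(μ k) = C)
    (hp : ∀ k, IsProbabilityMeasure (μ k)) {l r : Fin N → ℝ} (hc : CompatBoundary C l r)
    (hd : ∀ k, MemDCone (l k) (r k) (μ k)) (k : Fin N) :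
    (∃ t, l k ≤ t ∧ t ≤ r k ∧ μ k = lam (l k) t) ∨
    ∃ s t p, l k ≤ s ∧ s < t ∧ t ≤ r k ∧ 0 < p ∧ p < 1 ∧
      μ k = mix p (lam (l k) s) (lam (l k) t) := by
  have three := fun {M₁ M₂ M₃ : Measure ℝ} (d₁ : MemDCone (l k) (r k) M₁)
    (d₂ : MemDCone (l k) (r k) M₂) (d₃ : MemDCone (l k) (r k) M₃) {I J : Set ℝ} =>
    hμ.ne_add_three hC hp hc hd k d₁ d₂ d₃ (I := I) (J := J)
  have hpk := hp k
  obtain ⟨α, hα, ρ, h0, hanti, hz, hμk⟩ := hd k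
  obtain ⟨r', hlr', hr'r, hρ, hpos⟩ :=
    IsDens.exists_pos ⟨h0, hanti, hz⟩ (sub_nonneg.1 (hc k).1)
  change μ k = ENNReal.ofReal α • Measure.dirac (l k) + wd ρ at hμk
  generalize l k = L at *
  generalize r k = R at *
  rcases hlr'.eq_or_lt with rfl | hlr'
  · left
    have hw : wd ρ = 0 := by
      have : wd ρ = wd fun _ => 0 := by
        refine wd_congr ?_
        have hnull : ∀ᵐ x : ℝ, x ≠ L := by simp [ae_iff]
        filter_upwards [hnull] with x hx
        exact hρ.zero x fun h => hx (le_antisymm h.2 h.1)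
      rw [this]; simp [wd]
    have h1 : ENNReal.ofReal α = 1 := by
      have := measure_univ (μ := μ k)
      rw [hμk, hw] at this
      simpa using this
    exact ⟨L, le_rfl, hr'r, by rw [hμk, hw, h1, lam_self_s16]; simp⟩
  rcases exists_four_or_step hlr' (hρ.antitone.mono Set.Ioo_subset_Icc_self) with
    ⟨x, y₁, y₂, z, hx, hxy, hy, hyz, hz', hgt1, hgt2⟩ | ⟨s, a, b, hls, hsr, ha, hb⟩
  · exfalso
    have anti : ∀ {a b}, L < a → b < r' → a ≤ b → ρ b ≤ ρ a := fun ha hb hab =>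
      hρ.antitone ⟨ha.le, hab.trans hb.le⟩ ⟨ha.le.trans hab, hb.le⟩ hab
    obtain ⟨c', hc1, hc2⟩ := exists_between hgt1
    obtain ⟨c, hc3, hc4⟩ := exists_between hgt2
    have hcc : c < c' := (hc4.trans_le (anti (hx.trans hxy) (hyz.trans hz') hy.le)).trans hc1
    have hc0 : 0 ≤ c := (h0 z).trans hc3.le
    have hc0' : 0 ≤ c' := hc0.trans hcc.le
    have d1 := hρ.posPart hc0'
    have d2 := (hρ.min hc0').posPart hc0
    have d3 := (hρ.min hc0').min hc0
    refine three (M₁ := ENNReal.ofReal α • Measure.dirac L + wd fun x => max (ρ x - c') 0)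
      (((memDCone_dirac _ _).smul hα).add (d1.memDCone.mono hr'r))
      (d2.memDCone.mono hr'r) (d3.memDCone.mono hr'r) (I := Set.Ioo z r') (J := Set.Ioo y₁ y₂)
      ?_ ?_ ?_ ?_ ?_ ?_ ?_
    · rw [Measure.add_apply, smul_dirac_Ioo _ (by linarith), zero_add]
      refine wd_eq_zero measurableSet_Ioo fun w hw => max_eq_right ?_
      have := anti (a := z) (by linarith) hw.2 hw.1.le
      linarith
    · refine wd_eq_zero measurableSet_Ioo fun w hw => max_eq_right ?_
      have := anti (a := z) (by linarith) hw.2 hw.1.le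
      have := min_le_left (ρ w) c'
      linarith
    · refine wd_Ioo_ne_zero d3.measurable hz' fun w hw => ?_
      have hw0 := hpos z ⟨by linarith, hz'⟩
      exact lt_min (lt_min (hpos w ⟨by linarith [hw.1], hw.2⟩) (by linarith)) (by linarith)
    · rw [Measure.add_apply, smul_dirac_Ioo _ (by linarith), zero_add]
      refine wd_eq_zero measurableSet_Ioo fun w hw => max_eq_right ?_
      have := anti (a := y₁) (b := w) (by linarith) (by linarith [hw.2]) hw.1.le
      linarith
    · refine wd_Ioo_ne_zero d2.measurable hy fun w hw => lt_max_of_lt_left ?_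
      have := anti (a := w) (b := y₂) (by linarith [hw.1]) (by linarith) hw.2.le
      have := lt_min (hc4.trans_le this) hcc
      linarith
    · intro h
      rw [Measure.add_apply, add_eq_zero] at h
      refine wd_Ioo_ne_zero d1.measurable hx (fun w hw => lt_max_of_lt_left ?_)
        (measure_mono_null (Set.subset_univ _) h.2)
      have := anti (a := w) (b := x) hw.1 (by linarith) hw.2.le
      linarith
    · rw [hμk, hρ.wd_split hc0', (hρ.min hc0').wd_split hc0]
      abel
  · obtain ⟨s, u, v, hls, hsr, hu, hv, hus, hw⟩ := hρ.wd_eq_of_step hlr' hpos hls hsr ha hb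
    rw [hw] at hμk
    have hvd : 0 < v * (r' - L) := mul_pos hv (sub_pos.2 hlr')
    have hvl : ENNReal.ofReal v • volume.restrict (Set.Icc L r')
        = ENNReal.ofReal (v * (r' - L)) • lam L r' := by
      rw [restrict_Icc_eq_smul_lam hlr', smul_smul, ENNReal.ofReal_mul hv.le]
    have fin : ∀ p s, 0 ≤ p → L ≤ s → s < r' →
        μ k = ENNReal.ofReal p • lam L s + ENNReal.ofReal (v * (r' - L)) • lam L r' →
        (∃ t, L ≤ t ∧ t ≤ R ∧ μ k = lam L t) ∨
        ∃ s t p, L ≤ s ∧ s < t ∧ t ≤ R ∧ 0 < p ∧ p < 1 ∧ μ k = mix p (lam L s) (lam L t) := by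
      intro p s hp hLs hsr h
      have hone : v * (r' - L) = 1 - p := by
        have := measure_univ (μ := μ k)
        rw [h] at this
        simp only [Measure.coe_add, Measure.coe_smul, Pi.add_apply, Pi.smul_apply, measure_univ,
          smul_eq_mul, mul_one] at this
        rw [← ENNReal.ofReal_add hp hvd.le, ENNReal.ofReal_eq_one] at this
        linarith
      rw [hone] at h
      rcases hp.eq_or_lt with rfl | hp
      · exact Or.inl ⟨r', hlr'.le, hr'r, by simpa using h⟩
      · exact Or.inr ⟨s, r', p, hLs, hsr, hr'r, hp, by linarith, h⟩
    rcases hu.eq_or_lt with rfl | hu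
    · refine fin α L hα le_rfl hlr' ?_
      rw [hμk, hvl, lam_self_s16]
      simp
    rcases hα.eq_or_lt with rfl | hα
    · refine fin (u * (s - L)) s (mul_nonneg hu.le (sub_nonneg.2 hls)) hls hsr ?_
      rw [hμk, hvl, restrict_Icc_eq_smul_lam (hus hu), smul_smul, ENNReal.ofReal_mul hu.le]
      simp
    · exfalso
      have hLs := hus hu
      refine three ((memDCone_dirac L R).smul hα.le)
        (MemDCone.mono_left_restrict (hsr.le.trans hr'r) hu.le)
        (MemDCone.mono_left_restrict hr'r hv.le) (I := Set.Ioo s r') (J := Set.Ioo L s)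
        (smul_dirac_Ioo _ hls) ?_ (smul_restrict_Ioo_ne_zero hv hsr hls le_rfl)
        (smul_dirac_Ioo _ le_rfl) (smul_restrict_Ioo_ne_zero hu hLs le_rfl le_rfl)
        (by simpa using hα) (by rw [hμk]; abel)
      rw [Measure.smul_apply, Measure.restrict_apply measurableSet_Ioo]
      have : Set.Ioo s r' ∩ Set.Icc L s = ∅ := by
        ext w; simp only [Set.mem_inter_iff, Set.mem_Ioo, Set.mem_Icc, Set.mem_empty_iff_false,
          iff_false]; intro h; linarith [h.1.1, h.2.2]
      simp [this]

theorem sum_max_sub_le {ι : Type*} (s : Finset ι) {d : ι → ℝ} {y D : ℝ} (hy : 0 ≤ y)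
    (hD : 0 ≤ D) (h0 : ∀ j ∈ s, 0 ≤ d j) (h1 : ∀ j ∈ s, d j ≤ y + D)
    (h2 : ∑ j ∈ s, d j ≤ 2 * y + D) : ∑ j ∈ s, max 0 (d j - y) ≤ D := by
  classical
  by_cases hb : ∃ i ∈ s, ∃ j ∈ s, i ≠ j ∧ y < d i ∧ y < d j
  · obtain ⟨i, hi, j, hj, hij, hyi, hyj⟩ := hb
    have hj' : j ∈ s.erase i := Finset.mem_erase.2 ⟨hij.symm, hj⟩
    rw [← Finset.add_sum_erase s _ hi, ← Finset.add_sum_erase _ _ hj'] at h2 ⊢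
    have : ∑ k ∈ (s.erase i).erase j, max 0 (d k - y) ≤ ∑ k ∈ (s.erase i).erase j, d k :=
      Finset.sum_le_sum fun k hk => max_le
        (h0 k (Finset.mem_of_mem_erase (Finset.mem_of_mem_erase hk))) (by linarith)
    rw [max_eq_right (by linarith), max_eq_right (by linarith)]
    linarith
  · push Not at hb
    by_cases hi : ∃ i ∈ s, y < d i
    · obtain ⟨i, hi, hyi⟩ := hi
      rw [Finset.sum_eq_single_of_mem i hi fun j hj hji =>
        max_eq_left (by linarith [hb i hi j hj hji.symm hyi])]
      exact max_le hD (by linarith [h1 i hi])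
    · push Not at hi
      rw [Finset.sum_eq_zero fun j hj => max_eq_left (by linarith [hi j hj])]
      exact hD

theorem exists_sum_max_sub_eq {ι : Type*} (s : Finset ι) {d : ι → ℝ} {S D : ℝ} (hS : 0 ≤ S)
    (hD : 0 ≤ D) (h0 : ∀ j ∈ s, 0 ≤ d j) (h1 : ∀ j ∈ s, d j ≤ S + D)
    (h2 : ∑ j ∈ s, d j ≤ 2 * S + D) (h3 : D < ∑ j ∈ s, d j) :
    ∃ y, 0 < y ∧ y ≤ S ∧ ∑ j ∈ s, max 0 (d j - y) = D := by
  have hf : ContinuousOn (fun y => ∑ j ∈ s, max 0 (d j - y)) (Set.Icc 0 S) := by fun_prop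
  have hf0 : ∑ j ∈ s, max 0 (d j - 0) = ∑ j ∈ s, d j :=
    Finset.sum_congr rfl fun j hj => by rw [sub_zero, max_eq_right (h0 j hj)]
  obtain ⟨y, hy, hyD⟩ := intermediate_value_Icc' hS hf
    ⟨sum_max_sub_le s hS hD h0 h1 h2, by rw [hf0]; exact h3.le⟩
  refine ⟨y, lt_of_le_of_ne hy.1 ?_, hy.2, hyD⟩
  rintro rfl
  simp only [hf0] at hyD
  exact h3.ne' hyD

theorem mix_half_comm (μ ν : Measure ℝ) : mix (1 / 2) μ ν = mix (1 / 2) ν μ := by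
  rw [mix, mix, add_comm]
  norm_num

section Cases

variable {N : ℕ} {C : ℝ} {μ : Fin N → Measure ℝ} {l t : Fin N → ℝ}

theorem integral_mix_lam {p a s b : ℝ} (h0 : 0 ≤ p) (h1 : p ≤ 1) (has : a ≤ s) (hsb : s ≤ b) :
    ∫ x, x ∂(mix p (lam a s) (lam a b)) = p * ((a + s) / 2) + (1 - p) * ((a + b) / 2) := by
  rw [integral_mix ((memDCone_lam a s).integrable has)
    ((memDCone_lam a b).integrable (has.trans hsb)) h0 h1, integral_lam has,
    integral_lam (has.trans hsb)]

theorem Indecomposable.false_of_one_mix (hμ : Indecomposable C μ)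
    (hC : ∑ k, ∫ x, x ∂(μ k) = C) (hc : CompatBoundary C l t) {i : Fin N} {s p : ℝ}
    (hs : l i ≤ s) (hst : s < t i) (hp : 0 < p) (hp1 : p < 1)
    (hi : μ i = mix p (lam (l i) s) (lam (l i) (t i)))
    (hj : ∀ j ≠ i, μ j = lam (l j) (t j)) : False := by
  have hlt : ∀ k, l k ≤ t k := fun k => sub_nonneg.1 (hc k).1
  set S := C - ∑ k, l k with hS
  set D := (1 - p) * (t i - s) with hD
  have hD0 : 0 < D := mul_pos (by linarith) (by linarith)
  have hDlt : D < t i - s := by rw [hD]; nlinarith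
  have mi : ∫ x, x ∂(μ i) = (l i + s + D) / 2 := by
    rw [hi, integral_mix_lam hp.le hp1.le hs hst.le]; ring
  have sumd : ∑ j ∈ Finset.univ.erase i, (t j - l j) = 2 * S - (s - l i + D) := by
    rw [← Finset.add_sum_erase _ _ (Finset.mem_univ i), mi, Finset.sum_congr rfl
      (g := fun j => l j + (t j - l j) / 2) (fun j h => by
        rw [hj j (Finset.ne_of_mem_erase h), integral_lam (hlt j)]; ring),
      Finset.sum_add_distrib, ← Finset.sum_div] at hC
    have := Finset.add_sum_erase _ l (Finset.mem_univ i)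
    linarith
  have hSi : t i - l i ≤ S := (hc i).2
  obtain ⟨y, hy0, hyS, hy⟩ := exists_sum_max_sub_eq (Finset.univ.erase i)
    (d := fun j => t j - l j) (S := S - D) (D := D) (by linarith) hD0.le
    (fun j _ => (hc j).1) (fun j _ => by linarith [(hc j).2]) (by linarith) (by linarith)
  have hS0 : 0 < S := by linarith
  set x : Fin N → ℝ := fun j => max 0 (t j - l j - y) with hx
  set lA : Fin N → ℝ := fun j => if j = i then l i else l j + x j with hlA
  set rA : Fin N → ℝ := fun j => if j = i then s else t j with hrA
  have lAi : lA i = l i := by simp [hlA]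
  have rAi : rA i = s := by simp [hrA]
  have lAj : ∀ j ≠ i, lA j = l j + x j := fun j h => by simp [hlA, h]
  have rAj : ∀ j ≠ i, rA j = t j := fun j h => by simp [hrA, h]
  have hx0 : ∀ j, 0 ≤ x j := fun j => le_max_left _ _
  have hxd : ∀ j, x j ≤ t j - l j := fun j => max_le (hc j).1 (by linarith)
  have hxy : ∀ j, t j - l j - x j ≤ y := fun j => by
    linarith [le_max_right 0 (t j - l j - y)]
  have sumlA : ∑ k, lA k = ∑ k, l k + D := by
    rw [← Finset.add_sum_erase _ _ (Finset.mem_univ i), lAi, Finset.sum_congr rfl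
      (fun j h => lAj j (Finset.ne_of_mem_erase h)), Finset.sum_add_distrib, hy,
      ← Finset.add_sum_erase _ l (Finset.mem_univ i)]
    ring
  have cA : CompatBoundary C lA rA := by
    intro k
    rw [sumlA]
    by_cases h : k = i
    · subst h
      rw [lAi, rAi]
      exact ⟨by linarith, by linarith⟩
    · rw [lAj k h, rAj k h]
      exact ⟨by linarith [hxd k], by linarith [hxy k]⟩
  set β := min p (y / S) with hβ
  have hβ0 : 0 < β := lt_min hp (div_pos hy0 hS0)
  have hβp : β ≤ p := min_le_left _ _
  have hβS : β * S ≤ y := (le_div_iff₀ hS0).1 (min_le_right _ _)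
  have hβ1 : β < 1 := hβp.trans_lt hp1
  have hB : ∀ k, ∃ ν : Measure ℝ, IsProbabilityMeasure ν ∧ MemDCone (l k) (t k) ν ∧
      μ k = mix β (lam (lA k) (rA k)) ν := by
    intro k
    by_cases h : k = i
    · subst h
      have h1 : 0 < 1 - β := by linarith
      have q0 : 0 ≤ (p - β) / (1 - β) := div_nonneg (by linarith) h1.le
      have q1 : (p - β) / (1 - β) ≤ 1 := (div_le_one h1).2 (by linarith)
      have pν := isProbabilityMeasure_mix (μ := lam (l k) s) (ν := lam (l k) (t k)) q0 q1
      refine ⟨_, pν, memDCone_mix ((memDCone_lam _ _).mono hst.le) (memDCone_lam _ _) q0 q1, ?_⟩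
      rw [lAi, rAi, hi]
      have := isProbabilityMeasure_mix (μ := lam (l k) s) (ν := lam (l k) (t k)) hp.le hp1.le
      have := isProbabilityMeasure_mix (μ := lam (l k) s)
        (ν := mix ((p - β) / (1 - β)) (lam (l k) s) (lam (l k) (t k))) hβ0.le hβ1.le
      refine eq_of_real_eq fun w _ => ?_
      rw [mix_real hp.le hp1.le, mix_real hβ0.le hβ1.le, mix_real q0 q1]
      field_simp
      ring
    · rw [hj k h, lAj k h, rAj k h]
      refine exists_lam_eq_mix (by linarith [hx0 k]) (by linarith [hxd k]) hβ0 hβ1 ?_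
      rcases max_choice 0 (t k - l k - y) with h' | h'
      · have : x k = 0 := h'
        nlinarith [(hc k).1]
      · have : x k = t k - l k - y := h'
        nlinarith [(hc k).2]
  choose B pB dB hAB using hB
  have hA : (fun k => lam (lA k) (rA k)) = μ := by
    refine hμ.eq_left hC (fun _ => inferInstance) pB cA hc (fun k => memDCone_lam _ _) dB ?_
      hβ0 hβ1 hAB
    rw [Finset.sum_congr rfl fun k _ => integral_lam (sub_nonneg.1 (cA k).1),
      ← Finset.add_sum_erase _ _ (Finset.mem_univ i), lAi, rAi, Finset.sum_congr rfl
      (g := fun j => l j + ((t j - l j) / 2 + x j / 2)) (fun j h => by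
        rw [lAj j (Finset.ne_of_mem_erase h), rAj j (Finset.ne_of_mem_erase h)]; ring),
      Finset.sum_add_distrib, Finset.sum_add_distrib, ← Finset.sum_div, ← Finset.sum_div, hy,
      sumd]
    have := Finset.add_sum_erase _ l (Finset.mem_univ i)
    linarith
  have hAi := congrArg (fun σ => ∫ x, x ∂σ) (congrFun hA i)
  simp only [lAi, rAi, mi, integral_lam hs] at hAi
  linarith

theorem Indecomposable.false_of_two_mix (hμ : Indecomposable C μ)
    (hC : ∑ k, ∫ x, x ∂(μ k) = C) (hprob : ∀ k, IsProbabilityMeasure (μ k))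
    (hc : CompatBoundary C l t) (hd : ∀ k, MemDCone (l k) (t k) (μ k)) {i j : Fin N}
    (hij : i ≠ j) {s p s' p' : ℝ}
    (hs : l i ≤ s) (hst : s < t i) (hp : 0 < p) (hp1 : p < 1)
    (hi : μ i = mix p (lam (l i) s) (lam (l i) (t i)))
    (hs' : l j ≤ s') (hst' : s' < t j) (hp' : 0 < p') (hp1' : p' < 1)
    (hj : μ j = mix p' (lam (l j) s') (lam (l j) (t j))) : False := by
  set X := t i - s
  set Y := t j - s'
  have hX : 0 < X := sub_pos.2 hst
  have hY : 0 < Y := sub_pos.2 hst'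
  obtain ⟨ε, hε, e1, e2, e3, e4⟩ :
      ∃ ε : ℝ, 0 < ε ∧ ε * Y ≤ p ∧ ε * Y ≤ 1 - p ∧ ε * X ≤ p' ∧ ε * X ≤ 1 - p' := by
    have a1 : 0 < 1 - p := by linarith
    have a2 : 0 < 1 - p' := by linarith
    refine ⟨min (min (p / Y) ((1 - p) / Y)) (min (p' / X) ((1 - p') / X)), by positivity,
      ?_, ?_, ?_, ?_⟩
    · exact (le_div_iff₀ hY).1 ((min_le_left _ _).trans (min_le_left _ _))
    · exact (le_div_iff₀ hY).1 ((min_le_left _ _).trans (min_le_right _ _))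
    · exact (le_div_iff₀ hX).1 ((min_le_right _ _).trans (min_le_left _ _))
    · exact (le_div_iff₀ hX).1 ((min_le_right _ _).trans (min_le_right _ _))
  have hXe : 0 < ε * X := mul_pos hε hX
  have hYe : 0 < ε * Y := mul_pos hε hY
  set F : ℝ → Fin N → Measure ℝ := fun c k =>
    if k = i then mix (p + c * (ε * Y)) (lam (l i) s) (lam (l i) (t i))
    else if k = j then mix (p' - c * (ε * X)) (lam (l j) s') (lam (l j) (t j)) else μ k with hF
  have Fi : ∀ c, F c i = mix (p + c * (ε * Y)) (lam (l i) s) (lam (l i) (t i)) := by simp [hF]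
  have Fj : ∀ c, F c j = mix (p' - c * (ε * X)) (lam (l j) s') (lam (l j) (t j)) := by
    simp [hF, hij.symm]
  have Fk : ∀ c k, k ≠ i → k ≠ j → F c k = μ k := fun c k h1 h2 => by simp [hF, h1, h2]
  have bd : ∀ c : ℝ, c = 1 ∨ c = -1 → 0 ≤ p + c * (ε * Y) ∧ p + c * (ε * Y) ≤ 1 ∧
      0 ≤ p' - c * (ε * X) ∧ p' - c * (ε * X) ≤ 1 := by
    rintro c (rfl | rfl) <;> refine ⟨?_, ?_, ?_, ?_⟩ <;> linarith
  have pF : ∀ c : ℝ, c = 1 ∨ c = -1 → ∀ k, IsProbabilityMeasure (F c k) := by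
    intro c h k
    obtain ⟨b1, b2, b3, b4⟩ := bd c h
    by_cases h1 : k = i
    · rw [h1, Fi]; exact isProbabilityMeasure_mix b1 b2
    by_cases h2 : k = j
    · rw [h2, Fj]; exact isProbabilityMeasure_mix b3 b4
    rw [Fk c k h1 h2]; exact hprob k
  have dF : ∀ c : ℝ, c = 1 ∨ c = -1 → ∀ k, MemDCone (l k) (t k) (F c k) := by
    intro c h k
    obtain ⟨b1, b2, b3, b4⟩ := bd c h
    by_cases h1 : k = i
    · rw [h1, Fi]
      exact memDCone_mix ((memDCone_lam _ _).mono hst.le) (memDCone_lam _ _) b1 b2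
    by_cases h2 : k = j
    · rw [h2, Fj]
      exact memDCone_mix ((memDCone_lam _ _).mono hst'.le) (memDCone_lam _ _) b3 b4
    rw [Fk c k h1 h2]; exact hd k
  obtain ⟨b1, b2, b3, b4⟩ := bd 1 (Or.inl rfl)
  obtain ⟨b5, b6, b7, b8⟩ := bd (-1) (Or.inr rfl)
  have p1 := pF 1 (Or.inl rfl)
  have p2 := pF (-1) (Or.inr rfl)
  have mEi : ∫ x, x ∂(F 1 i) - ∫ x, x ∂(μ i) = -(ε * Y * X / 2) := by
    rw [Fi, hi, integral_mix_lam b1 b2 hs hst.le, integral_mix_lam hp.le hp1.le hs hst.le]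
    ring
  have mEj : ∫ x, x ∂(F 1 j) - ∫ x, x ∂(μ j) = ε * Y * X / 2 := by
    rw [Fj, hj, integral_mix_lam b3 b4 hs' hst'.le,
      integral_mix_lam hp'.le hp1'.le hs' hst'.le]
    ring
  have hA : F 1 = μ := by
    refine hμ.eq_left hC p1 p2 hc hc (dF 1 (Or.inl rfl)) (dF (-1) (Or.inr rfl)) ?_
      (β := 1 / 2) (by norm_num) (by norm_num) ?_
    · rw [← hC, ← sub_eq_zero, ← Finset.sum_sub_distrib, Fintype.sum_eq_add i j hij
        (fun k hk => by rw [Fk 1 k hk.1 hk.2, sub_self]), mEi, mEj]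
      ring
    · intro k
      have := hprob k
      have := p1 k
      have := p2 k
      have := isProbabilityMeasure_mix (a := 1 / 2) (μ := F 1 k) (ν := F (-1) k)
        (by norm_num) (by norm_num)
      refine eq_of_real_eq fun w _ => ?_
      rw [mix_real (by norm_num) (by norm_num)]
      by_cases h1 : k = i
      · subst h1
        rw [Fi, Fi, hi, mix_real b1 b2, mix_real b5 b6, mix_real hp.le hp1.le]; ring
      by_cases h2 : k = j
      · subst h2
        rw [Fj, Fj, hj, mix_real b3 b4, mix_real b7 b8, mix_real hp'.le hp1'.le]; ring
      rw [Fk _ k h1 h2, Fk _ k h1 h2]; ring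
  rw [hA, sub_self] at mEj
  have : 0 < ε * Y * X := by positivity
  linarith

theorem sum_width_of_uniform (hC : ∑ k, ∫ x, x ∂(μ k) = C) (hlt : ∀ k, l k ≤ t k)
    (hu : ∀ k, μ k = lam (l k) (t k)) : ∑ k, (t k - l k) = 2 * (C - ∑ k, l k) := by
  rw [Finset.sum_congr rfl (g := fun j => l j + (t j - l j) / 2) (fun j _ => by
    rw [hu j, integral_lam (hlt j)]; ring), Finset.sum_add_distrib, ← Finset.sum_div] at hC
  linarith

theorem Indecomposable.false_of_tight (hμ : Indecomposable C μ)
    (hC : ∑ k, ∫ x, x ∂(μ k) = C) (hc : CompatBoundary C l t)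
    (hu : ∀ k, μ k = lam (l k) (t k)) {i : Fin N} (hi : t i - l i = C - ∑ k, l k)
    (hpos : 0 < t i - l i) : False := by
  have hlt : ∀ k, l k ≤ t k := fun k => sub_nonneg.1 (hc k).1
  have hsum := sum_width_of_uniform hC hlt hu
  rw [← Finset.add_sum_erase _ _ (Finset.mem_univ i)] at hsum
  have hl := Finset.add_sum_erase _ l (Finset.mem_univ i)
  have hE : ∀ k ∈ Finset.univ.erase i, t k - l k ≤ t i - l i := fun k _ => by
    linarith [(hc k).2]
  set m : Fin N → ℝ := fun k => (l k + t k) / 2 with hm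
  set lA : Fin N → ℝ := fun k => if k = i then m k else l k with hlA
  set rA : Fin N → ℝ := fun k => if k = i then t k else m k with hrA
  set lB : Fin N → ℝ := fun k => if k = i then l k else m k with hlB
  set rB : Fin N → ℝ := fun k => if k = i then m k else t k with hrB
  have sumA : ∑ k, lA k = ∑ k, l k + (t i - l i) / 2 := by
    rw [← Finset.add_sum_erase _ _ (Finset.mem_univ i), Finset.sum_congr rfl
      (g := l) (fun j h => by simp [hlA, Finset.ne_of_mem_erase h])]
    simp only [hlA, if_true, hm]
    linarith
  have sumB : ∑ k, lB k = ∑ k, l k + (t i - l i) / 2 := by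
    rw [← Finset.add_sum_erase _ _ (Finset.mem_univ i), Finset.sum_congr rfl
      (g := fun j => l j + (t j - l j) / 2)
      (fun j h => by simp only [hlB, Finset.ne_of_mem_erase h, if_false, hm]; ring),
      Finset.sum_add_distrib, ← Finset.sum_div]
    simp only [hlB, if_true]
    linarith
  have cA : CompatBoundary C lA rA := by
    intro k
    rw [sumA]
    have := hc k
    by_cases h : k = i <;> simp only [hlA, hrA, h, if_true, if_false, hm] <;>
      constructor <;> linarith
  have cB : CompatBoundary C lB rB := by
    intro k
    rw [sumB]
    have := hc k
    by_cases h : k = i <;> simp only [hlB, hrB, h, if_true, if_false, hm] <;>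
      constructor <;> linarith
  have hA : (fun k => lam (lA k) (rA k)) = μ := by
    refine hμ.eq_left (B := fun k => lam (lB k) (rB k)) hC (fun _ => inferInstance)
      (fun _ => inferInstance) cA cB
      (fun _ => memDCone_lam _ _) (fun _ => memDCone_lam _ _) ?_ (β := 1 / 2) (by norm_num)
      (by norm_num) fun k => ?_
    · rw [Finset.sum_congr rfl fun k _ => integral_lam (sub_nonneg.1 (cA k).1),
        ← Finset.add_sum_erase _ _ (Finset.mem_univ i), Finset.sum_congr rfl
        (g := fun j => l j + (t j - l j) / 4) (fun j h => by
          simp only [hlA, hrA, Finset.ne_of_mem_erase h, if_false, hm]; ring),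
        Finset.sum_add_distrib, ← Finset.sum_div]
      simp only [hlA, hrA, if_true, hm]
      linarith
    · rw [hu k]
      by_cases h : k = i
      · simp only [hlA, hrA, hlB, hrB, h, if_true, hm]
        rw [mix_half_comm]
        exact lam_eq_mix_half (hlt i)
      · simp only [hlA, hrA, hlB, hrB, h, if_false, hm]
        exact lam_eq_mix_half (hlt k)
  have hAi := congrArg (fun σ => ∫ x, x ∂σ) (congrFun hA i)
  simp only [hlA, hrA, if_true, hm, hu i] at hAi
  rw [integral_lam (hlt i), integral_lam (by linarith)] at hAi
  linarith

theorem Indecomposable.false_of_not_tight (hμ : Indecomposable C μ)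
    (hC : ∑ k, ∫ x, x ∂(μ k) = C) (hc : CompatBoundary C l t)
    (hu : ∀ k, μ k = lam (l k) (t k)) (hnt : ∀ k, t k - l k < C - ∑ k, l k) {i j : Fin N}
    (hij : i ≠ j) (hi : l i < t i) (hj : l j < t j) : False := by
  have hlt : ∀ k, l k ≤ t k := fun k => sub_nonneg.1 (hc k).1
  have : Nonempty (Fin N) := ⟨i⟩
  obtain ⟨k₀, hk₀⟩ := Finite.exists_max fun k => t k - l k
  obtain ⟨x, hx0, hxi, hxj, hxk⟩ : ∃ x : ℝ, 0 < x ∧ x ≤ (t i - l i) / 2 ∧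
      x ≤ (t j - l j) / 2 ∧ x ≤ C - ∑ k, l k - (t k₀ - l k₀) := by
    have h1 : 0 < (t i - l i) / 2 := by linarith
    have h2 : 0 < (t j - l j) / 2 := by linarith
    have h3 : 0 < C - ∑ k, l k - (t k₀ - l k₀) := by linarith [hnt k₀]
    exact ⟨min (min _ _) _, lt_min (lt_min h1 h2) h3, (min_le_left _ _).trans (min_le_left _ _),
      (min_le_left _ _).trans (min_le_right _ _), min_le_right _ _⟩
  obtain ⟨νi, pi, di, ei⟩ := exists_lam_eq_mix (l := l i) (m := l i + x) (t := t i) (β := 1 / 2)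
    (by linarith) (by linarith) (by norm_num) (by norm_num) (by linarith)
  obtain ⟨νj, pj, dj, ej⟩ := exists_lam_eq_mix (l := l j) (m := l j + x) (t := t j) (β := 1 / 2)
    (by linarith) (by linarith) (by norm_num) (by norm_num) (by linarith)
  have mj : ∫ x, x ∂νj = (l j + t j - x) / 2 := by
    have := congrArg (fun σ => ∫ x, x ∂σ) ej
    rw [integral_mix ((memDCone_lam _ _).integrable (by linarith)) (dj.integrable (hlt j))
      (by norm_num) (by norm_num), integral_lam (hlt j), integral_lam (by linarith)] at this
    linarith
  have compat : ∀ k, CompatBoundary C (Function.update l k (l k + min x (t k - l k))) t := by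
    intro k
    have hs : ∑ q, Function.update l k (l k + min x (t k - l k)) q
        = ∑ q, l q + min x (t k - l k) := by
      rw [Finset.sum_update_of_mem (Finset.mem_univ k), Finset.sdiff_singleton_eq_erase,
        ← Finset.add_sum_erase _ l (Finset.mem_univ k)]
      ring
    intro q
    rw [hs]
    have h1 := min_le_left x (t k - l k)
    have h2 := min_le_right x (t k - l k)
    have h3 : 0 ≤ min x (t k - l k) := le_min hx0.le (hc k).1
    have h4 := hk₀ q
    rcases eq_or_ne q k with rfl | h
    · rw [Function.update_self]
      exact ⟨by linarith, by linarith⟩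
    · rw [Function.update_of_ne h]
      exact ⟨(hc q).1, by linarith⟩
  have cA := compat i
  have cB := compat j
  rw [min_eq_left (by linarith)] at cA cB
  set A : Fin N → Measure ℝ := fun k =>
    if k = i then lam (l i + x) (t i) else if k = j then νj else μ k with hA
  set B : Fin N → Measure ℝ := fun k =>
    if k = i then νi else if k = j then lam (l j + x) (t j) else μ k with hB
  have Ai : A i = lam (l i + x) (t i) := by simp [hA]
  have Bi : B i = νi := by simp [hB]
  have Aj : A j = νj := by simp [hA, hij.symm]
  have Bj : B j = lam (l j + x) (t j) := by simp [hB, hij.symm]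
  have Ak : ∀ k, k ≠ i → k ≠ j → A k = lam (l k) (t k) := fun k h1 h2 => by
    simp [hA, h1, h2, hu]
  have Bk : ∀ k, k ≠ i → k ≠ j → B k = lam (l k) (t k) := fun k h1 h2 => by
    simp [hB, h1, h2, hu]
  have tri : ∀ P : Fin N → Prop, P i → P j → (∀ k, k ≠ i → k ≠ j → P k) → ∀ k, P k := by
    intro P h1 h2 h3 k
    by_cases hk1 : k = i
    · exact hk1 ▸ h1
    by_cases hk2 : k = j
    · exact hk2 ▸ h2
    exact h3 k hk1 hk2
  have key : A = μ := by
    refine hμ.eq_left (B := B) hC ?_ ?_ cA cB ?_ ?_ ?_ (β := 1 / 2) (by norm_num) (by norm_num) ?_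
    · refine tri _ ?_ ?_ fun k h1 h2 => ?_
      · rw [Ai]; infer_instance
      · rw [Aj]; exact pj
      · rw [Ak k h1 h2]; infer_instance
    · refine tri _ ?_ ?_ fun k h1 h2 => ?_
      · rw [Bi]; exact pi
      · rw [Bj]; infer_instance
      · rw [Bk k h1 h2]; infer_instance
    · refine tri _ ?_ ?_ fun k h1 h2 => ?_
      · rw [Ai, Function.update_self]; exact memDCone_lam _ _
      · rw [Aj, Function.update_of_ne hij.symm]; exact dj
      · rw [Ak k h1 h2, Function.update_of_ne h1]; exact memDCone_lam _ _
    · refine tri _ ?_ ?_ fun k h1 h2 => ?_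
      · rw [Bi, Function.update_of_ne hij]; exact di
      · rw [Bj, Function.update_self]; exact memDCone_lam _ _
      · rw [Bk k h1 h2, Function.update_of_ne h2]; exact memDCone_lam _ _
    · rw [← hC, ← sub_eq_zero, ← Finset.sum_sub_distrib, Fintype.sum_eq_add i j hij
        (fun k hk => by rw [Ak k hk.1 hk.2, hu k, sub_self]), Ai, Aj, hu i, hu j, mj,
        integral_lam (hlt i), integral_lam (hlt j), integral_lam (by linarith)]
      ring
    · refine tri _ ?_ ?_ fun k h1 h2 => ?_
      · rw [Ai, Bi, hu i, ei]
      · rw [Aj, Bj, hu j, mix_half_comm, ej]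
      · rw [Ak k h1 h2, Bk k h1 h2, hu k, mix_self (by norm_num) (by norm_num)]
  have h := congrArg (fun σ => ∫ x, x ∂σ) (congrFun key i)
  rw [Ai, hu i, integral_lam (hlt i), integral_lam (by linarith)] at h
  linarith

theorem Indecomposable.exists_eq_dirac (hμ : Indecomposable C μ) (hV : memV C μ)
    (hprob : ∀ k, IsProbabilityMeasure (μ k)) :
    ∃ l : Fin N → ℝ, ∑ k, l k = C ∧ ∀ k, μ k = Measure.dirac (l k) := by
  obtain ⟨hC, l, r, hc, hd⟩ := hV
  have hform : ∀ k, ∃ t s p, l k ≤ t ∧ t ≤ r k ∧ (μ k = lam (l k) t ∨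
      (l k ≤ s ∧ s < t ∧ 0 < p ∧ p < 1 ∧ μ k = mix p (lam (l k) s) (lam (l k) t))) := by
    intro k
    rcases hμ.uniform_or_mix hC hprob hc (fun k => memDCone_of_memD (hd k)) k with
      ⟨t, h1, h2, h3⟩ | ⟨s, t, p, h1, h2, h3, h4, h5, h6⟩
    · exact ⟨t, 0, 0, h1, h2, Or.inl h3⟩
    · exact ⟨t, s, p, h1.trans h2.le, h3, Or.inr ⟨h1, h2, h4, h5, h6⟩⟩
  choose t s p hlt htr hform using hform
  have hc' : CompatBoundary C l t := fun k =>
    ⟨sub_nonneg.2 (hlt k), (sub_le_sub_right (htr k) _).trans (hc k).2⟩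
  have hd' : ∀ k, MemDCone (l k) (t k) (μ k) := by
    intro k
    rcases hform k with h | ⟨-, h2, h3, h4, h⟩
    · rw [h]; exact memDCone_lam _ _
    · rw [h]
      exact memDCone_mix ((memDCone_lam _ _).mono h2.le) (memDCone_lam _ _) h3.le h4.le
  by_cases hu : ∀ k, μ k = lam (l k) (t k)
  · have hsum := sum_width_of_uniform hC hlt hu
    by_cases hS : C - ∑ k, l k ≤ 0
    · have heq : ∀ k, t k = l k := fun k => by linarith [hc' k]
      have h0 : ∑ k, (t k - l k) = 0 := Finset.sum_eq_zero fun k _ => by rw [heq, sub_self]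
      exact ⟨l, by linarith, fun k => by rw [hu k, heq k, lam_self_s16]⟩
    push Not at hS
    exfalso
    by_cases ht : ∃ i, t i - l i = C - ∑ k, l k
    · obtain ⟨i, hi⟩ := ht
      exact hμ.false_of_tight hC hc' hu hi (by linarith)
    push Not at ht
    have hnt : ∀ k, t k - l k < C - ∑ k, l k := fun k => lt_of_le_of_ne (hc' k).2 (ht k)
    obtain ⟨i, -, hi⟩ := Finset.exists_lt_of_sum_lt (s := Finset.univ) (f := fun _ => (0 : ℝ))
      (g := fun k => t k - l k) (by rw [hsum, Finset.sum_const_zero]; linarith)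
    have hsum' := Finset.add_sum_erase _ (fun k => t k - l k) (Finset.mem_univ i)
    obtain ⟨j, hji, hj⟩ := Finset.exists_lt_of_sum_lt (s := Finset.univ.erase i)
      (f := fun _ => (0 : ℝ)) (g := fun k => t k - l k)
      (by rw [Finset.sum_const_zero]; linarith [hnt i])
    exact hμ.false_of_not_tight hC hc' hu hnt (Finset.ne_of_mem_erase hji).symm
      (sub_pos.1 hi) (sub_pos.1 hj)
  · exfalso
    push Not at hu
    obtain ⟨i, hi⟩ := hu
    obtain ⟨h1, h2, h3, h4, h5⟩ := (hform i).resolve_left hi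
    by_cases hj : ∀ j ≠ i, μ j = lam (l j) (t j)
    · exact hμ.false_of_one_mix hC hc' h1 h2 h3 h4 h5 hj
    · push Not at hj
      obtain ⟨j, hji, hj⟩ := hj
      obtain ⟨g1, g2, g3, g4, g5⟩ := (hform j).resolve_left hj
      exact hμ.false_of_two_mix hC hprob hc' hd' hji.symm h1 h2 h3 h4 h5 g1 g2 g3 g4 g5

end Cases

theorem eq_dirac_of_measure_compl_eq_zero {μ : Measure ℝ} [IsProbabilityMeasure μ] {l : ℝ}
    (h : μ {l}ᶜ = 0) : μ = Measure.dirac l := by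
  have h1 : μ {l} = 1 := (prob_compl_eq_zero_iff (measurableSet_singleton l)).1 h
  have h2 : μ.restrict {l} = μ := Measure.restrict_eq_self_of_ae_mem h
  rw [← h2, Measure.restrict_singleton, h1, one_smul]

/-- a tuple of probability measures is a subextreme point of V^N[C] iff it is
a tuple of Dirac measures (δ_{l₁},…,δ_{l_N}) with l₁+⋯+l_N = C. -/
theorem stmt16 {N : ℕ} (C : ℝ) (μ : Fin N → Measure ℝ)
    (hprob : ∀ k, IsProbabilityMeasure (μ k)) :
    (memV C μ ∧
      ∀ (μ₁ μ₂ : Fin N → Measure ℝ),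
        (∀ k, IsProbabilityMeasure (μ₁ k)) → (∀ k, IsProbabilityMeasure (μ₂ k)) →
        memV C μ₁ → memV C μ₂ → ∀ α : ℝ, 0 < α → α < 1 →
        (∀ k, μ k = ENNReal.ofReal α • μ₁ k + ENNReal.ofReal (1 - α) • μ₂ k) →
        μ₁ = μ₂)
    ↔ ∃ l : Fin N → ℝ, (∑ k, l k) = C ∧ ∀ k, μ k = Measure.dirac (l k) := by
  constructor
  · rintro ⟨hV, hμ⟩
    exact Indecomposable.exists_eq_dirac hμ hV hprob
  · rintro ⟨l, hl, h⟩
    refine ⟨⟨by simp [h, hl], l, l, fun k => by simp [hl], fun k => ?_⟩, ?_⟩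
    · rw [h k]
      exact (memDCone_dirac _ _).memD
    · intro μ₁ μ₂ p₁ p₂ _ _ α h0 h1 hmix
      have hz : ∀ k, μ₁ k {l k}ᶜ = 0 ∧ μ₂ k {l k}ᶜ = 0 := by
        intro k
        have hk : μ k {l k}ᶜ = 0 := by simp [h k]
        rw [hmix k] at hk
        simpa [h0.not_ge, h1.not_ge] using hk
      funext k
      have := p₁ k
      have := p₂ k
      rw [eq_dirac_of_measure_compl_eq_zero (hz k).1,
        eq_dirac_of_measure_compl_eq_zero (hz k).2]
end
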